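/- For every n ≥ 2, the number of bigrassmannian elements of full support in the symmetric group S_{n+1} (type A_n) equals n; for every n ≥ 2, the number of bigrassmannian elements of full support in W(B_n) equals n(n+1)(n+2)/6; and for every n ≥ 4, the number of bigrassmannian elements of full support in W(D_n) equals (n−2)(n² + 8n − 15)/6. -/

import Mathlib

open CoxeterSystem

namespace NilpotencyIndices

variable {B : Type*} {W : Type*} [Group W] {M : CoxeterMatrix B}

/-- The set `Γ(W)` of triples `(w, i, j)` with `ℓ(sᵢ w sⱼ) = ℓ(w) - 2`
(stated as `ℓ(sᵢ w sⱼ) + 2 = ℓ(w)` to avoid truncated subtraction). -/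
def InGamma (cs : CoxeterSystem M W) (x : W × B × B) : Prop :=
  cs.length (cs.simple x.2.1 * x.1 * cs.simple x.2.2) + 2 = cs.length x.1

/-- The weak left (Bruhat) order: `v ≤_L w` iff `ℓ(v) + ℓ(w v⁻¹) = ℓ(w)`. -/
def WeakLeftLE (cs : CoxeterSystem M W) (v w : W) : Prop :=
  cs.length v + cs.length (w * v⁻¹) = cs.length w

/-- The weak right (Bruhat) order: `v ≤_R w` iff `ℓ(v) + ℓ(v⁻¹ w) = ℓ(w)`. -/
def WeakRightLE (cs : CoxeterSystem M W) (v w : W) : Prop :=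
  cs.length v + cs.length (v⁻¹ * w) = cs.length w

/-- `v(α_a) = α_b`: the group-theoretic condition `v sₐ v⁻¹ = s_b` and `ℓ(v sₐ) = ℓ(v) + 1`. -/
def MapsSimple (cs : CoxeterSystem M W) (v : W) (a b : B) : Prop :=
  v * cs.simple a * v⁻¹ = cs.simple b ∧ cs.length (v * cs.simple a) = cs.length v + 1

/-- `(w, i, j) →_L (u, i', j')` iff both triples are in `Γ(W)`, `u ≤_L w`, `j' = j`, and
`(w u⁻¹)(α_{i'}) = α_i`. -/
def RedL (cs : CoxeterSystem M W) (x y : W × B × B) : Prop :=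
  InGamma cs x ∧ InGamma cs y ∧ WeakLeftLE cs y.1 x.1 ∧ y.2.2 = x.2.2 ∧
    MapsSimple cs (x.1 * y.1⁻¹) y.2.1 x.2.1

/-- `(w, i, j) →_R (u, i', j')` iff both triples are in `Γ(W)`, `u ≤_R w`, `i' = i`, and
`(u⁻¹ w)(α_j) = α_{j'}`. -/
def RedR (cs : CoxeterSystem M W) (x y : W × B × B) : Prop :=
  InGamma cs x ∧ InGamma cs y ∧ WeakRightLE cs y.1 x.1 ∧ y.2.1 = x.2.1 ∧
    MapsSimple cs (y.1⁻¹ * x.1) x.2.2 y.2.2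

/-- `→`: the reflexive-transitive closure of the union of `→_L` and `→_R`. -/
def Red (cs : CoxeterSystem M W) : (W × B × B) → (W × B × B) → Prop :=
  Relation.ReflTransGen (fun x y => RedL cs x y ∨ RedR cs x y)

/-- `↔`: the equivalence relation generated by `→`. -/
def EquivRed (cs : CoxeterSystem M W) : (W × B × B) → (W × B × B) → Prop :=
  Relation.EqvGen (Red cs)

/-- The alternating word `a, b, a, b, …` with `n` letters, starting with `a`. -/
def altWord (a b : B) : ℕ → List B
  | 0 => []
  | n + 1 => a :: altWord b a n

/-- `w₀(a, b)`: the alternating product `sₐ s_b sₐ ⋯` with `M a b` factors, the longest element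
of the subgroup generated by `sₐ` and `s_b` when `M a b` is finite (i.e. nonzero). -/
def w0 (cs : CoxeterSystem M W) (a b : B) : W :=
  cs.wordProd (altWord a b (M a b))

/-- An element is bigrassmannian if it has exactly one left descent and exactly one
right descent. -/
def Bigrassmannian (cs : CoxeterSystem M W) (w : W) : Prop :=
  (∃! i, cs.IsLeftDescent w i) ∧ (∃! j, cs.IsRightDescent w j)

/-- The support of `w`: the set of indices appearing in some reduced word for `w`. -/
def Supp (cs : CoxeterSystem M W) (w : W) : Set B :=
  {i | ∃ l : List B, cs.IsReduced l ∧ cs.wordProd l = w ∧ i ∈ l}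

/-- The relation `(w, i, j) →_{(k,L)} (u, i', j')`. -/
def RedkL (cs : CoxeterSystem M W) (k : B) (x y : W × B × B) : Prop :=
  cs.length y.1 < cs.length x.1 ∧ RedR cs (x.1 * cs.simple k, x.2.1, x.2.2) x ∧
    RedL cs (x.1 * cs.simple k, x.2.1, x.2.2) y ∧ WeakLeftLE cs y.1 x.1

/-- The relation `(w, i, j) →_{(k,R)} (u, i', j')`. -/
def RedkR (cs : CoxeterSystem M W) (k : B) (x y : W × B × B) : Prop :=
  cs.length y.1 < cs.length x.1 ∧ RedL cs (cs.simple k * x.1, x.2.1, x.2.2) x ∧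
    RedR cs (cs.simple k * x.1, x.2.1, x.2.2) y ∧ WeakRightLE cs y.1 x.1

/-- The orthogonality condition for a bigrassmannian element `w` with `D_L(w) = {i}` and
`D_R(w) = {j}`. -/
def OrthCond (cs : CoxeterSystem M W) (w : W) (i j : B) : Prop :=
  (∀ a b : B, M a j = 2 → MapsSimple cs w a b → M b i = 2) ∧
  (∀ a b : B, M a i = 2 → MapsSimple cs w⁻¹ a b → M b j = 2)

theorem pos_of_not_isRightDescent (cs : CoxeterSystem M W) {A : B → B → ℤ} {D : W → B → ℤ}
    (hone : ∀ s, 0 < D 1 s)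
    (hmul : ∀ w t s, D (w * cs.simple t) s = D w s - A t s * D w t)
    (hA : ∀ s, A s s = 2)
    (hM : ∀ s t, s ≠ t → (M s t = 2 ∧ A s t = 0 ∧ A t s = 0) ∨
      (M s t = 3 ∧ A s t = -1 ∧ A t s = -1) ∨
      (M s t = 4 ∧ A s t < 0 ∧ A t s < 0 ∧ A s t * A t s = 2)) (w : W) :
    ∀ s, ¬ cs.IsRightDescent w s → 0 < D w s := by
  induction hk : cs.length w using Nat.strong_induction_on generalizing w with
  | _ k ih =>
  intro s hs
  subst hk
  have key : ∀ v r, cs.length v < cs.length w → ¬ cs.IsRightDescent v r → 0 < D v r :=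
    fun v r hv hr => ih _ hv v rfl r hr
  have cancel : ∀ (v : W) (r : B), v * cs.simple r * cs.simple r = v := by
    intro v r; simp
  have hback : ∀ v r, cs.IsRightDescent v r → ¬ cs.IsRightDescent (v * cs.simple r) r := by
    intro v r h
    exact cs.isRightDescent_iff_not_isRightDescent_mul.1 h
  by_cases hw : w = 1
  · rw [hw]; exact hone s
  obtain ⟨t, ht⟩ := cs.exists_rightDescent_of_ne_one hw
  have hst : s ≠ t := by rintro rfl; exact hs ht
  have hlw : cs.length w ≤ cs.length (w * cs.simple s) := not_lt.1 hs
  have hl1 : cs.length (w * cs.simple t) + 1 = cs.length w := cs.isRightDescent_iff.1 ht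
  have e1 := hmul (w * cs.simple t) t s
  rw [cancel] at e1
  have p1 := key _ t (by omega) (hback _ _ ht)
  by_cases h1 : cs.IsRightDescent (w * cs.simple t) s
  swap
  · have p2 := key _ s (by omega) h1
    have : A t s ≤ 0 := by rcases hM s t hst with h | h | h <;> omega
    nlinarith
  have hl2 := cs.isRightDescent_iff.1 h1
  have e2s := hmul (w * cs.simple t * cs.simple s) s s
  have e2t := hmul (w * cs.simple t * cs.simple s) s t
  rw [cancel, hA] at e2s
  rw [cancel] at e2t
  have p2 := key _ s (by omega) (hback _ _ h1)
  have pow_eq := cs.simple_mul_simple_pow s t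
  rcases hM s t hst with ⟨m, a, b⟩ | ⟨m, a, b⟩ | ⟨m, a, b, c⟩
  · exfalso
    rw [m] at pow_eq
    have : w * cs.simple s = w * cs.simple t * cs.simple s * cs.simple t := by
      rw [← mul_one (w * cs.simple s), ← pow_eq]; simp [pow_succ, mul_assoc]
    have h := cs.length_mul_le (w * cs.simple t * cs.simple s) (cs.simple t)
    rw [← this, cs.length_simple] at h
    omega
  · by_cases h2 : cs.IsRightDescent (w * cs.simple t * cs.simple s) t
    · exfalso
      have hl3 := cs.isRightDescent_iff.1 h2
      have : w * cs.simple s = w * cs.simple t * cs.simple s * cs.simple t *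
          (cs.simple s * cs.simple t) := by
        rw [← mul_one (w * cs.simple s), ← pow_eq, m]; simp [pow_succ, mul_assoc]
      have h := cs.length_mul_le (w * cs.simple t * cs.simple s * cs.simple t)
         (cs.simple s * cs.simple t)
      have h' := cs.length_mul_le (cs.simple s) (cs.simple t)
      rw [← this] at h
      simp only [cs.length_simple] at h'
      omega
    · have p3 := key _ t (by omega) h2
      rw [e1, e2s, e2t, a, b]
      linarith
  · by_cases h2 : cs.IsRightDescent (w * cs.simple t * cs.simple s) t
    · have hl3 := cs.isRightDescent_iff.1 h2
      have e3s := hmul (w * cs.simple t * cs.simple s * cs.simple t) t s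
      have e3t := hmul (w * cs.simple t * cs.simple s * cs.simple t) t t
      rw [cancel] at e3s
      rw [cancel, hA] at e3t
      have p3 := key _ t (by omega) (hback _ _ h2)
      by_cases h3 : cs.IsRightDescent (w * cs.simple t * cs.simple s * cs.simple t) s
      · exfalso
        have hl4 := cs.isRightDescent_iff.1 h3
        have : w * cs.simple s = w * cs.simple t * cs.simple s * cs.simple t * cs.simple s *
          (cs.simple t * cs.simple s * cs.simple t) := by
          rw [← mul_one (w * cs.simple s), ← pow_eq, m]; simp [pow_succ, mul_assoc]
        have h := cs.length_mul_le (w * cs.simple t * cs.simple s * cs.simple t * cs.simple s)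
          (cs.simple t * cs.simple s * cs.simple t)
        have h' := cs.length_mul_le (cs.simple t * cs.simple s) (cs.simple t)
        have h'' := cs.length_mul_le (cs.simple t) (cs.simple s)
        rw [← this] at h
        simp only [cs.length_simple] at h' h''
        omega
      · have p4 := key _ s (by omega) h3
        have : D w s = D (w * cs.simple t * cs.simple s * cs.simple t) s := by
          rw [e1, e2s, e2t, e3s, e3t]
          linear_combination (D (w * cs.simple t * cs.simple s * cs.simple t) s -
            A t s * D (w * cs.simple t * cs.simple s * cs.simple t) t) * c
        linarith
    · have p3 := key _ t (by omega) h2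
      have : D w s = (A s t * A t s - 1) * D (w * cs.simple t * cs.simple s) s
          - A t s * D (w * cs.simple t * cs.simple s) t := by
        rw [e1, e2s, e2t]; ring
      rw [c] at this
      nlinarith

theorem isRightDescent_iff_neg (cs : CoxeterSystem M W) {A : B → B → ℤ} {D : W → B → ℤ}
    (hone : ∀ s, 0 < D 1 s)
    (hmul : ∀ w t s, D (w * cs.simple t) s = D w s - A t s * D w t)
    (hA : ∀ s, A s s = 2)
    (hM : ∀ s t, s ≠ t → (M s t = 2 ∧ A s t = 0 ∧ A t s = 0) ∨
      (M s t = 3 ∧ A s t = -1 ∧ A t s = -1) ∨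
      (M s t = 4 ∧ A s t < 0 ∧ A t s < 0 ∧ A s t * A t s = 2)) (w : W) (s : B) :
    cs.IsRightDescent w s ↔ D w s < 0 := by
  constructor
  · intro h
    have h1 := pos_of_not_isRightDescent cs hone hmul hA hM _ s
      (cs.isRightDescent_iff_not_isRightDescent_mul.1 h)
    have h2 := hmul w s s
    rw [hA] at h2
    linarith
  · intro h
    by_contra hs
    have := pos_of_not_isRightDescent cs hone hmul hA hM w s hs
    omega

theorem mem_supp_iff_of_invariant (cs : CoxeterSystem M W) (c : B) (Q : W → Prop) (hone : Q 1)
    (hmul : ∀ w s, s ≠ c → Q w → Q (w * cs.simple s))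
    (hdesc : ∀ w, Q w → ¬ cs.IsRightDescent w c) (w : W) : c ∈ Supp cs w ↔ ¬ Q w := by
  have hred : ∀ (l : List B) (s : B), cs.IsReduced (l ++ [s]) →
      cs.IsReduced l ∧ cs.IsRightDescent (cs.wordProd (l ++ [s])) s := by
    intro l s h
    have h1 : cs.IsReduced l := by simpa using h.take l.length
    refine ⟨h1, ?_⟩
    have h2 := h.eq
    have h3 := h1.eq
    rw [CoxeterSystem.IsRightDescent, h2, cs.wordProd_append]
    simp [h3]
  constructor
  · rintro ⟨l, hl, rfl, hc⟩
    induction l using List.reverseRecOn with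
    | nil => simp at hc
    | append_singleton l s ih =>
      obtain ⟨h1, h2⟩ := hred l s hl
      intro hQ
      have hsc : s ≠ c := by rintro rfl; exact hdesc _ hQ h2
      have hc' : c ∈ l := by
        rcases List.mem_append.1 hc with h | h
        · exact h
        · exact absurd (List.mem_singleton.1 h).symm hsc
      refine ih h1 hc' ?_
      have := hmul _ s hsc hQ
      simpa [cs.wordProd_append] using this
  · intro hQ
    obtain ⟨l, hl, rfl⟩ := cs.exists_isReduced w
    by_contra hc
    have hcl : c ∉ l := fun h => hc ⟨l, hl, rfl, h⟩
    clear hc hl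
    apply hQ
    clear hQ
    induction l using List.reverseRecOn with
    | nil => simpa using hone
    | append_singleton l s ih =>
      rw [cs.wordProd_append]
      simp only [CoxeterSystem.wordProd_singleton]
      refine hmul _ s ?_ (ih fun h => hcl (by simp [h]))
      rintro rfl
      simp at hcl

open Equiv

/-- The sign change `1 ↔ -1` of `ℤ`. -/
def signFlip : Perm ℤ :=
  Function.Involutive.toPerm (fun k => if k = 1 then -1 else if k = -1 then 1 else k)
    (by intro k; grind)

/-- The odd permutation of `ℤ` that exchanges `c` and `c + 1` when `c ≥ 1`, and changes the sign
of `1` when `c = 0`. -/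
def adjSwap (c : ℕ) : Perm ℤ :=
  Function.Involutive.toPerm (fun k => if c = 0 then signFlip k else
    if k = c then c + 1 else if k = c + 1 then c
    else if k = -c then -(c + 1) else if k = -(c + 1) then -c else k)
    (by
      intro k
      by_cases hc : c = 0
      · simp only [hc, if_true]
        exact Function.Involutive.toPerm_involutive _ k
      · simp only [hc, if_false]; split_ifs <;> omega)

/-- The odd permutation of `ℤ` given by `1 ↦ -2`, `2 ↦ -1`. -/
def forkSwap : Perm ℤ :=
  Function.Involutive.toPerm (fun k => if k = 1 then -2 else if k = 2 then -1
    else if k = -1 then 2 else if k = -2 then 1 else k)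
    (by intro k; grind)

theorem signFlip_apply (k : ℤ) : signFlip k = if k = 1 then -1 else if k = -1 then 1 else k := rfl

theorem adjSwap_zero : adjSwap 0 = signFlip := by ext k; rfl

theorem adjSwap_apply {c : ℕ} (hc : 1 ≤ c) (k : ℤ) : adjSwap c k =
    if k = c then (c : ℤ) + 1 else if k = c + 1 then (c : ℤ)
    else if k = -c then -((c : ℤ) + 1) else if k = -(c + 1) then -(c : ℤ) else k := by
  have : c ≠ 0 := by omega
  change (if c = 0 then _ else _) = _
  rw [if_neg this]

theorem forkSwap_apply (k : ℤ) : forkSwap k = if k = 1 then -2 else if k = 2 then -1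
    else if k = -1 then 2 else if k = -2 then 1 else k := rfl

theorem adjSwap_mul_self (c : ℕ) : adjSwap c * adjSwap c = 1 := by
  ext k; exact Function.Involutive.toPerm_involutive _ k

theorem forkSwap_mul_self : forkSwap * forkSwap = 1 := by
  ext k; exact Function.Involutive.toPerm_involutive _ k

theorem signFlip_mul_self : signFlip * signFlip = 1 := by
  ext k; exact Function.Involutive.toPerm_involutive _ k

theorem signFlip_neg (k : ℤ) : signFlip (-k) = -signFlip k := by
  simp only [signFlip_apply]; split_ifs <;> omega

theorem adjSwap_neg (c : ℕ) (k : ℤ) : adjSwap c (-k) = -adjSwap c k := by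
  rcases Nat.eq_zero_or_pos c with rfl | hc
  · rw [adjSwap_zero, signFlip_neg]
  · simp only [adjSwap_apply hc]; split_ifs <;> omega

theorem forkSwap_neg (k : ℤ) : forkSwap (-k) = -forkSwap k := by
  simp only [forkSwap_apply]; split_ifs <;> omega

theorem adjSwap_self {c : ℕ} (hc : 1 ≤ c) : adjSwap c c = c + 1 := by
  simp [adjSwap_apply hc]

theorem adjSwap_succ {c : ℕ} (hc : 1 ≤ c) : adjSwap c (c + 1) = c := by
  simp [adjSwap_apply hc]

theorem adjSwap_of_ne {c : ℕ} {k : ℤ} (h1 : k ≠ c) (h2 : k ≠ c + 1) (h3 : k ≠ -c)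
    (h4 : k ≠ -(c + 1)) : adjSwap c k = k := by
  rcases Nat.eq_zero_or_pos c with rfl | hc
  · rw [adjSwap_zero, signFlip_apply]; split_ifs <;> omega
  · simp only [adjSwap_apply hc]; split_ifs <;> omega

theorem forkSwap_of_ne {k : ℤ} (h1 : k ≠ 1) (h2 : k ≠ 2) (h3 : k ≠ -1) (h4 : k ≠ -2) :
    forkSwap k = k := by
  rw [forkSwap_apply]; split_ifs <;> omega

theorem signFlip_of_ne {k : ℤ} (h1 : k ≠ 1) (h2 : k ≠ -1) : signFlip k = k := by
  rw [signFlip_apply]; split_ifs <;> omega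

theorem signFlip_one : signFlip 1 = -1 := rfl

theorem forkSwap_one : forkSwap 1 = -2 := rfl

theorem forkSwap_two : forkSwap 2 = -1 := rfl

theorem adjSwap_mul_pow_two {c d : ℕ} (h : c + 2 ≤ d) : (adjSwap c * adjSwap d) ^ 2 = 1 := by
  ext k
  simp only [pow_succ, pow_zero, one_mul, Perm.mul_apply, Perm.one_apply]
  rcases Nat.eq_zero_or_pos c with rfl | hc
  · simp only [adjSwap_zero]
    by_cases h : k = 1 ∨ k = -1 ∨ k = d ∨ k = d + 1 ∨ k = -d ∨ k = -(d + 1)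
    · rcases h with rfl | rfl | rfl | rfl | rfl | rfl <;>
        simp (disch := omega) only [adjSwap_self, adjSwap_succ, signFlip_one, adjSwap_neg,
          signFlip_neg, adjSwap_of_ne, signFlip_of_ne, neg_neg]
    · simp (disch := omega) only [adjSwap_of_ne, signFlip_of_ne]
  · by_cases h : k = c ∨ k = c + 1 ∨ k = -c ∨ k = -(c + 1) ∨
      k = d ∨ k = d + 1 ∨ k = -d ∨ k = -(d + 1)
    · rcases h with rfl | rfl | rfl | rfl | rfl | rfl | rfl | rfl <;>
        simp (disch := omega) only [adjSwap_self, adjSwap_succ, adjSwap_neg, adjSwap_of_ne]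
    · simp (disch := omega) only [adjSwap_of_ne]

theorem adjSwap_mul_pow_three {c : ℕ} (h : 1 ≤ c) : (adjSwap c * adjSwap (c + 1)) ^ 3 = 1 := by
  ext k
  have h1 := adjSwap_self (show 1 ≤ c + 1 by omega)
  have h2 := adjSwap_succ (show 1 ≤ c + 1 by omega)
  push_cast at h1 h2
  simp only [pow_succ, pow_zero, one_mul, Perm.mul_apply, Perm.one_apply]
  by_cases hk : k = c ∨ k = c + 1 ∨ k = -c ∨ k = -(c + 1) ∨ k = c + 1 + 1 ∨ k = -(c + 1 + 1)
  · rcases hk with rfl | rfl | rfl | rfl | rfl | rfl <;>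
      simp (disch := push_cast; omega) only [adjSwap_self, adjSwap_succ, adjSwap_neg, h1, h2,
        adjSwap_of_ne]
  · simp (disch := push_cast; omega) only [adjSwap_of_ne]

theorem adjSwap_mul_pow_four : (adjSwap 0 * adjSwap 1) ^ 4 = 1 := by
  ext k
  simp only [pow_succ, pow_zero, one_mul, Perm.mul_apply, Perm.one_apply, adjSwap_zero,
    adjSwap_apply le_rfl, signFlip_apply]
  by_cases h : k = 1 ∨ k = 2 ∨ k = -1 ∨ k = -2
  · rcases h with rfl | rfl | rfl | rfl <;> simp
  · simp only [not_or] at h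
    simp [h]

theorem forkSwap_mul_adjSwap_one : (forkSwap * adjSwap 1) ^ 2 = 1 := by
  ext k
  simp only [pow_succ, pow_zero, one_mul, Perm.mul_apply, Perm.one_apply, 
    adjSwap_apply le_rfl, forkSwap_apply]
  by_cases h : k = 1 ∨ k = 2 ∨ k = -1 ∨ k = -2
  · rcases h with rfl | rfl | rfl | rfl <;> simp
  · simp only [not_or] at h
    simp [h]

theorem forkSwap_mul_adjSwap_two : (forkSwap * adjSwap 2) ^ 3 = 1 := by
  ext k
  simp only [pow_succ, pow_zero, one_mul, Perm.mul_apply, Perm.one_apply, 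
    adjSwap_apply one_le_two, forkSwap_apply]
  by_cases h : k = 1 ∨ k = 2 ∨ k = -1 ∨ k = -2 ∨ k = 3 ∨ k = -3
  · rcases h with rfl | rfl | rfl | rfl | rfl | rfl <;> simp
  · simp only [not_or] at h
    simp [h]

theorem forkSwap_mul_adjSwap {d : ℕ} (h : 3 ≤ d) : (forkSwap * adjSwap d) ^ 2 = 1 := by
  ext k
  simp only [pow_succ, pow_zero, one_mul, Perm.mul_apply, Perm.one_apply]
  by_cases h : k = 1 ∨ k = 2 ∨ k = -1 ∨ k = -2 ∨ k = d ∨ k = d + 1 ∨ k = -d ∨ k = -(d + 1)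
  · rcases h with rfl | rfl | rfl | rfl | rfl | rfl | rfl | rfl <;>
      simp (disch := omega) only [adjSwap_self, adjSwap_succ, adjSwap_neg, adjSwap_of_ne,
        forkSwap_one, forkSwap_two, forkSwap_neg, forkSwap_of_ne, neg_neg]
  · simp (disch := omega) only [adjSwap_of_ne, forkSwap_of_ne]

/-- The group of signed permutations of `{1, …, N}`, as odd permutations of `ℤ` that fix every
integer larger than `N`. -/
def signedPerm (N : ℕ) : Subgroup (Perm ℤ) where
  carrier := {g | (∀ k, g (-k) = -g k) ∧ ∀ k : ℤ, N < k → g k = k}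
  one_mem' := ⟨fun _ => rfl, fun _ _ => rfl⟩
  mul_mem' := by
    rintro g h ⟨hg1, hg2⟩ ⟨hh1, hh2⟩
    refine ⟨fun k => ?_, fun k hk => ?_⟩
    · simp [hh1, hg1]
    · simp [hh2 k hk, hg2 k hk]
  inv_mem' := by
    rintro g ⟨hg1, hg2⟩
    refine ⟨fun k => ?_, fun k hk => ?_⟩
    · rw [Perm.inv_eq_iff_eq, hg1]; simp
    · rw [Perm.inv_eq_iff_eq, hg2 k hk]

section SignedPerm
variable {N : ℕ} {g h : Perm ℤ}

theorem map_neg_of_mem (hg : g ∈ signedPerm N) (k : ℤ) : g (-k) = -g k := hg.1 k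

theorem map_of_lt_of_mem (hg : g ∈ signedPerm N) {k : ℤ} (hk : N < k) : g k = k := hg.2 k hk

theorem map_zero_of_mem (hg : g ∈ signedPerm N) : g 0 = 0 := by
  have := hg.1 0
  simp at this
  omega

theorem map_le_of_mem (hg : g ∈ signedPerm N) {k : ℤ} (hk : k ≤ N) : g k ≤ N := by
  by_contra h
  have h1 := hg.2 (g k) (by omega)
  have h2 := g.injective h1
  omega

theorem neg_le_map_of_mem (hg : g ∈ signedPerm N) {k : ℤ} (hk : -N ≤ k) : -N ≤ g k := by
  have := map_le_of_mem hg (k := -k) (by omega)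
  rw [hg.1] at this
  omega

theorem map_pos_ne_zero (hg : g ∈ signedPerm N) {k : ℤ} (hk : k ≠ 0) : g k ≠ 0 := by
  intro h
  rw [← map_zero_of_mem hg] at h
  exact hk (g.injective h)

theorem ext_of_mem (hg : g ∈ signedPerm N) (hh : h ∈ signedPerm N)
    (H : ∀ k : ℤ, 1 ≤ k → k ≤ N → g k = h k) : g = h := by
  have H' : ∀ k : ℤ, 1 ≤ k → g k = h k := by
    intro k hk
    by_cases hN : k ≤ N
    · exact H k hk hN
    · rw [hg.2 k (by omega), hh.2 k (by omega)]
  ext k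
  rcases lt_trichotomy k 0 with hk | rfl | hk
  · have := H' (-k) (by omega)
    rw [hg.1, hh.1] at this
    omega
  · rw [map_zero_of_mem hg, map_zero_of_mem hh]
  · exact H' k hk

theorem adjSwap_mem {c : ℕ} (hc : c + 1 ≤ N) : adjSwap c ∈ signedPerm N :=
  ⟨adjSwap_neg c, fun k hk => adjSwap_of_ne (by omega) (by omega) (by omega) (by omega)⟩

theorem signFlip_mem (hN : 1 ≤ N) : signFlip ∈ signedPerm N :=
  adjSwap_zero ▸ adjSwap_mem (by omega)

theorem forkSwap_mem (hN : 2 ≤ N) : forkSwap ∈ signedPerm N :=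
  ⟨forkSwap_neg, fun k hk => forkSwap_of_ne (by omega) (by omega) (by omega) (by omega)⟩

theorem eq_one_of_strictMono (hg : g ∈ signedPerm N)
    (H : ∀ c : ℕ, c < N → g c < g (c + 1)) : g = 1 := by
  have h0 := map_zero_of_mem hg
  have hlow : ∀ c : ℕ, c ≤ N → (c : ℤ) ≤ g c := by
    intro c
    induction c with
    | zero => intro _; simp [h0]
    | succ c ih =>
      intro hc
      have := ih (by omega)
      have := H c (by omega)
      push_cast
      omega
  have hup : ∀ d c : ℕ, c + d = N → g c ≤ c := by
    intro d
    induction d with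
    | zero =>
      intro c hc
      have := map_le_of_mem hg (k := c) (by omega)
      omega
    | succ d ih =>
      intro c hc
      have h1 := ih (c + 1) (by omega)
      have h2 := H c (by omega)
      push_cast at h1
      omega
  refine ext_of_mem hg (one_mem _) fun k hk1 hk2 => ?_
  lift k to ℕ using by omega
  have := hlow k (by omega)
  have := hup (N - k) k (by omega)
  simp only [Perm.one_apply]
  omega

/-- The statistic `∑ k * g k`, which increases whenever a descent of `g` is removed. -/
noncomputable def weight (N : ℕ) (g : Perm ℤ) : ℤ := ∑ k ∈ Finset.Icc (1 : ℤ) N, k * g k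

theorem weight_le (hg : g ∈ signedPerm N) : weight N g ≤ ∑ k ∈ Finset.Icc (1 : ℤ) N, k * N := by
  refine Finset.sum_le_sum fun k hk => ?_
  rw [Finset.mem_Icc] at hk
  exact mul_le_mul_of_nonneg_left (map_le_of_mem hg hk.2) (by omega)

theorem weight_sub_weight {c : ℤ} (hc : 1 ≤ c) (hcN : c + 1 ≤ N)
    (hk : ∀ k : ℤ, 1 ≤ k → k ≠ c → k ≠ c + 1 → h k = g k) :
    weight N h - weight N g = c * (h c - g c) + (c + 1) * (h (c + 1) - g (c + 1)) := by
  rw [weight, weight, ← Finset.sum_sub_distrib]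
  have hsub : ({c, c + 1} : Finset ℤ) ⊆ Finset.Icc 1 (N : ℤ) := by
    intro k hk
    simp only [Finset.mem_insert, Finset.mem_singleton] at hk
    rw [Finset.mem_Icc]
    omega
  rw [← Finset.sum_subset hsub, Finset.sum_pair (by omega)]
  · ring
  · intro k hk1 hk2
    simp only [Finset.mem_insert, Finset.mem_singleton, not_or] at hk2
    rw [hk k (Finset.mem_Icc.1 hk1).1 hk2.1 hk2.2, sub_self]

theorem weight_lt_mul_adjSwap {c : ℕ} (hc : 1 ≤ c) (hcN : c + 1 ≤ N) (hd : g (c + 1) < g c) :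
    weight N g < weight N (g * adjSwap c) := by
  have := weight_sub_weight (g := g) (h := g * adjSwap c) (N := N) (c := c) (by omega) (by omega)
    (fun k h1 h2 h3 => by
      rw [Perm.mul_apply, adjSwap_of_ne h2 h3 (by omega) (by omega)])
  simp only [Perm.mul_apply, adjSwap_self hc, adjSwap_succ hc] at this
  nlinarith

theorem weight_lt_mul_forkSwap (hN : 2 ≤ N) (hg : g ∈ signedPerm N) (hd : g 1 + g 2 < 0) :
    weight N g < weight N (g * forkSwap) := by
  have := weight_sub_weight (g := g) (h := g * forkSwap) (N := N) (c := 1) (by omega) (by omega)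
    (fun k h1 h2 h3 => by
      rw [Perm.mul_apply, forkSwap_of_ne h2 (by omega) (by omega) (by omega)])
  norm_num [Perm.mul_apply, forkSwap_one, forkSwap_two, map_neg_of_mem hg] at this
  linarith

theorem weight_lt_mul_signFlip (hN : 1 ≤ N) (hg : g ∈ signedPerm N) (hd : g 1 < 0) :
    weight N g < weight N (g * signFlip) := by
  rw [weight, weight]
  refine Finset.sum_lt_sum (fun k hk => ?_) ⟨1, by rw [Finset.mem_Icc]; omega, ?_⟩
  · rw [Finset.mem_Icc] at hk
    by_cases h1 : k = 1
    · subst h1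
      simp only [Perm.mul_apply, signFlip_one, map_neg_of_mem hg]
      omega
    · rw [Perm.mul_apply, signFlip_of_ne h1 (by omega)]
  · simp only [Perm.mul_apply, signFlip_one, map_neg_of_mem hg]
    omega

theorem exists_mul_of_weight_lt {G : Type*} [Group G] (φ : G →* Perm ℤ) {C Z : Perm ℤ → Prop}
    (hCN : ∀ g, C g → g ∈ signedPerm N)
    (hstep : ∀ g, C g → Z g ∨ ∃ w, C (g * φ w) ∧ weight N g < weight N (g * φ w)) (hg : C g) :
    ∃ w, Z (g * φ w) := by
  obtain ⟨m, hm⟩ : ∃ m : ℕ, (∑ k ∈ Finset.Icc (1 : ℤ) N, k * N) - weight N g < m :=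
    ⟨((∑ k ∈ Finset.Icc (1 : ℤ) N, k * N) - weight N g + 1).toNat, by omega⟩
  induction m generalizing g with
  | zero =>
    have := weight_le (hCN g hg)
    push_cast at hm
    omega
  | succ m ih =>
    rcases hstep g hg with hZ | ⟨w, hw1, hw2⟩
    · exact ⟨1, by simpa using hZ⟩
    · obtain ⟨v, hv⟩ := ih hw1 (by push_cast at hm; omega)
      exact ⟨w * v, by simpa [mul_assoc] using hv⟩

end SignedPerm

theorem mul_pow_eq_one_symm {G : Type*} [Group G] {a b : G} {m : ℕ} (ha : a * a = 1)
    (hb : b * b = 1) (h : (a * b) ^ m = 1) : (b * a) ^ m = 1 := by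
  have ha' : a⁻¹ = a := inv_eq_of_mul_eq_one_left ha
  have hb' : b⁻¹ = b := inv_eq_of_mul_eq_one_left hb
  rw [← inv_eq_one, ← inv_pow, mul_inv_rev, ha', hb', h]

/-- The diagram condition saying that `node` embeds the Coxeter diagram into the diagram of
type `B`, whose double bond joins the nodes `0` and `1`. -/
def IsChainNode (M : CoxeterMatrix B) (node : B → ℕ) : Prop :=
  ∀ s t, s ≠ t → (M s t = 2 ∧ (node s + 2 ≤ node t ∨ node t + 2 ≤ node s)) ∨
    (M s t = 3 ∧ 1 ≤ node s ∧ 1 ≤ node t ∧ (node s + 1 = node t ∨ node t + 1 = node s)) ∨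
    (M s t = 4 ∧ (node s = 0 ∧ node t = 1 ∨ node s = 1 ∧ node t = 0))

/-- The diagram condition saying that `node` embeds the Coxeter diagram into the diagram of
type `D`, whose nodes `0` and `1` are both joined to the node `2`. -/
def IsForkNode (M : CoxeterMatrix B) (node : B → ℕ) : Prop :=
  ∀ s t, s ≠ t →
    (M s t = 2 ∧ (node s = 0 ∧ node t = 1 ∨ node s = 1 ∧ node t = 0 ∨
      node s = 0 ∧ 3 ≤ node t ∨ node t = 0 ∧ 3 ≤ node s ∨
      1 ≤ node s ∧ node s + 2 ≤ node t ∨ 1 ≤ node t ∧ node t + 2 ≤ node s)) ∨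
    (M s t = 3 ∧ (node s = 0 ∧ node t = 2 ∨ node s = 2 ∧ node t = 0 ∨
      1 ≤ node s ∧ node s + 1 = node t ∨ 1 ≤ node t ∧ node t + 1 = node s))

/-- The images of the simple reflections of type `D`. -/
def forkGen (c : ℕ) : Perm ℤ := if c = 0 then forkSwap else adjSwap c

/-- The pairing of `g` with the simple root of type `D` at the node `c`. -/
def forkValue (g : Perm ℤ) (c : ℕ) : ℤ := if c = 0 then g 1 + g 2 else g (c + 1) - g c

theorem forkGen_zero : forkGen 0 = forkSwap := rfl

theorem forkGen_of_ne {c : ℕ} (hc : 1 ≤ c) : forkGen c = adjSwap c := if_neg (by omega)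

theorem forkValue_zero (g : Perm ℤ) : forkValue g 0 = g 1 + g 2 := rfl

theorem forkValue_of_ne (g : Perm ℤ) {c : ℕ} (hc : 1 ≤ c) :
    forkValue g c = g (c + 1) - g c := if_neg (by omega)

theorem forkGen_mul_self (c : ℕ) : forkGen c * forkGen c = 1 := by
  unfold forkGen
  split_ifs
  · exact forkSwap_mul_self
  · exact adjSwap_mul_self c

theorem forkGen_mem {N c : ℕ} (hN : 2 ≤ N) (hc : c + 1 ≤ N) : forkGen c ∈ signedPerm N := by
  unfold forkGen
  split_ifs
  · exact forkSwap_mem hN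
  · exact adjSwap_mem hc

theorem adjSwap_value_mul {g : Perm ℤ} (h0 : g 0 = 0) (hneg : ∀ k, g (-k) = -g k) (c d : ℕ) :
    (g * adjSwap c) (d + 1) - (g * adjSwap c) d = g (d + 1) - g d -
      (if d = c then 2 else if d + 1 = c then -1 else
        if c + 1 = d then (if c = 0 then -2 else -1) else 0) * (g (c + 1) - g c) := by
  simp only [Perm.mul_apply]
  rcases Nat.eq_zero_or_pos c with rfl | hc
  · rw [adjSwap_zero]
    rcases lt_trichotomy d 1 with hd | rfl | hd
    · obtain rfl : d = 0 := by omega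
      simp [signFlip_one, hneg, h0, signFlip_of_ne]
      ring
    · simp [signFlip_one, hneg, h0, signFlip_of_ne]
      ring
    · rw [signFlip_of_ne (by omega) (by omega), signFlip_of_ne (by omega) (by omega)]
      rw [if_neg (by omega), if_neg (by omega), if_neg (by omega)]
      ring
  · by_cases h1 : d = c
    · subst h1
      rw [adjSwap_self hc, adjSwap_succ hc, if_pos rfl]
      ring
    by_cases h2 : d + 1 = c
    · subst h2
      push_cast
      rw [if_neg h1, if_pos rfl, adjSwap_of_ne (k := d) (by omega) (by omega) (by omega) (by omega)]
      have := adjSwap_self hc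
      push_cast at this
      rw [this]
      ring
    by_cases h3 : c + 1 = d
    · subst h3
      push_cast
      rw [if_neg h1, if_neg h2, if_pos rfl, if_neg (by omega), adjSwap_succ hc,
        adjSwap_of_ne (by omega) (by omega) (by omega) (by omega)]
      ring
    · rw [adjSwap_of_ne (by omega) (by omega) (by omega) (by omega),
        adjSwap_of_ne (by omega) (by omega) (by omega) (by omega), if_neg h1, if_neg h2, if_neg h3]
      ring

theorem forkValue_mul_forkGen {g : Perm ℤ} (hneg : ∀ k, g (-k) = -g k) (c d : ℕ) :
    forkValue (g * forkGen c) d = forkValue g d -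
      (if d = c then 2 else
        if (1 ≤ d ∧ d + 1 = c) ∨ (1 ≤ c ∧ c + 1 = d) ∨ (d = 0 ∧ c = 2) ∨ (d = 2 ∧ c = 0)
        then -1 else 0) * forkValue g c := by
  rcases Nat.eq_zero_or_pos c with rfl | hc
  · rw [forkGen_zero, forkValue_zero]
    rcases Nat.eq_zero_or_pos d with rfl | hd
    · simp [forkValue_zero, forkSwap_one, forkSwap_two, hneg]
      ring
    rw [forkValue_of_ne _ hd, forkValue_of_ne _ hd]
    simp only [Perm.mul_apply]
    by_cases h1 : d = 1
    · subst h1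
      norm_num [forkSwap_one, forkSwap_two, hneg]
      ring
    by_cases h2 : d = 2
    · subst h2
      norm_num [forkSwap_two, hneg, forkSwap_of_ne]
      ring
    · rw [forkSwap_of_ne (by omega) (by omega) (by omega) (by omega),
        forkSwap_of_ne (by omega) (by omega) (by omega) (by omega), if_neg (by omega),
        if_neg (by omega)]
      ring
  · rw [forkGen_of_ne hc, forkValue_of_ne g hc]
    rcases Nat.eq_zero_or_pos d with rfl | hd
    · rw [forkValue_zero, forkValue_zero, if_neg (by omega)]
      simp only [Perm.mul_apply]
      by_cases h1 : c = 1
      · subst h1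
        have e1 := adjSwap_self (c := 1) le_rfl
        have e2 := adjSwap_succ (c := 1) le_rfl
        norm_num at e1 e2
        norm_num [e1, e2]
        ring
      rw [adjSwap_of_ne (k := 1) (by omega) (by omega) (by omega) (by omega)]
      by_cases h2 : c = 2
      · subst h2
        have e1 := adjSwap_self (c := 2) (by norm_num)
        norm_num at e1
        norm_num [e1]
        ring
      · rw [adjSwap_of_ne (by omega) (by omega) (by omega) (by omega), if_neg (by omega)]
        ring
    rw [forkValue_of_ne _ hd, forkValue_of_ne _ hd]
    simp only [Perm.mul_apply]
    by_cases h1 : d = c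
    · subst h1
      rw [adjSwap_self hc, adjSwap_succ hc, if_pos rfl]
      ring
    by_cases h2 : d + 1 = c
    · subst h2
      have := adjSwap_self hc
      push_cast at this ⊢
      rw [if_neg h1, if_pos (by omega), this,
        adjSwap_of_ne (k := d) (by omega) (by omega) (by omega) (by omega)]
      ring
    by_cases h3 : c + 1 = d
    · subst h3
      push_cast
      rw [if_neg h1, if_pos (by omega), adjSwap_succ hc,
        adjSwap_of_ne (by omega) (by omega) (by omega) (by omega)]
      ring
    · rw [adjSwap_of_ne (by omega) (by omega) (by omega) (by omega),
        adjSwap_of_ne (by omega) (by omega) (by omega) (by omega), if_neg h1, if_neg (by omega)]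
      ring

section Hom
variable (cs : CoxeterSystem M W) {node : B → ℕ} {N : ℕ}

theorem mem_of_simple_mem {G : Type*} [Group G] {φ : W →* G} {H : Subgroup G}
    (h : ∀ s, φ (cs.simple s) ∈ H) (w : W) : φ w ∈ H := by
  induction w using cs.simple_induction_left with
  | one => simp
  | mul_simple_left w s ih => rw [map_mul]; exact H.mul_mem (h s) ih

theorem isLiftable_adjSwap (hM : IsChainNode M node) :
    M.IsLiftable fun s => adjSwap (node s) := by
  intro s t
  beta_reduce
  have hsym : ∀ {c d m : ℕ}, (adjSwap c * adjSwap d) ^ m = 1 → (adjSwap d * adjSwap c) ^ m = 1 :=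
    fun h => mul_pow_eq_one_symm (adjSwap_mul_self _) (adjSwap_mul_self _) h
  by_cases hst : s = t
  · subst hst
    simp [adjSwap_mul_self]
  rcases hM s t hst with ⟨m, h | h⟩ | ⟨m, h1, h2, h | h⟩ | ⟨m, ⟨h1, h2⟩ | ⟨h1, h2⟩⟩ <;> rw [m]
  · exact adjSwap_mul_pow_two h
  · exact hsym (adjSwap_mul_pow_two h)
  · rw [← h]; exact adjSwap_mul_pow_three h1
  · rw [← h]; exact hsym (adjSwap_mul_pow_three h2)
  · rw [h1, h2]; exact adjSwap_mul_pow_four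
  · rw [h1, h2]; exact hsym adjSwap_mul_pow_four

theorem exists_hom_of_isChainNode (hM : IsChainNode M node) (hN : ∀ s, node s + 1 ≤ N) :
    ∃ φ : W →* Perm ℤ, (∀ s, φ (cs.simple s) = adjSwap (node s)) ∧ (∀ w, φ w ∈ signedPerm N) ∧
      ∀ w s, cs.IsRightDescent w s ↔ φ w (node s + 1) < φ w (node s) := by
  refine ⟨cs.lift ⟨_, isLiftable_adjSwap hM⟩, fun s => cs.lift_apply_simple _ s, ?_⟩
  set φ := cs.lift ⟨_, isLiftable_adjSwap hM⟩
  have hs : ∀ s, φ (cs.simple s) = adjSwap (node s) := fun s => cs.lift_apply_simple _ s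
  have hmem : ∀ w, φ w ∈ signedPerm N := mem_of_simple_mem cs fun s => by
    rw [hs]; exact adjSwap_mem (hN s)
  refine ⟨hmem, fun w s => ?_⟩
  rw [← sub_neg (a := φ w (node s + 1))]
  refine isRightDescent_iff_neg cs (D := fun w s => φ w (node s + 1) - φ w (node s))
    (A := fun t s => if node s = node t then 2 else
      if node s + 1 = node t then -1 else
      if node t + 1 = node s then (if node t = 0 then -2 else -1) else 0) ?_ ?_ ?_ ?_ w s
  · intro s; simp
  · intro w t s
    have h0 := map_zero_of_mem (hmem w)
    have hneg := map_neg_of_mem (hmem w)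
    simp only [map_mul, hs]
    exact adjSwap_value_mul h0 hneg _ _
  · intro s; simp
  · intro s t hst
    rcases hM s t hst with ⟨m, h | h⟩ | ⟨m, h1, h2, h | h⟩ | ⟨m, ⟨h1, h2⟩ | ⟨h1, h2⟩⟩ <;>
      simp only [m] <;> grind

theorem isLiftable_forkGen (hM : IsForkNode M node) :
    M.IsLiftable fun s => forkGen (node s) := by
  intro s t
  beta_reduce
  have hsym : ∀ {c d m : ℕ}, (forkGen c * forkGen d) ^ m = 1 → (forkGen d * forkGen c) ^ m = 1 :=
    fun h => mul_pow_eq_one_symm (forkGen_mul_self _) (forkGen_mul_self _) h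
  have hfar : ∀ {c d : ℕ}, 1 ≤ c → c + 2 ≤ d → (forkGen c * forkGen d) ^ 2 = 1 := by
    intro c d hc hd
    rw [forkGen_of_ne hc, forkGen_of_ne (by omega)]
    exact adjSwap_mul_pow_two hd
  have hnear : ∀ {c : ℕ}, 1 ≤ c → (forkGen c * forkGen (c + 1)) ^ 3 = 1 := by
    intro c hc
    rw [forkGen_of_ne hc, forkGen_of_ne (by omega)]
    exact adjSwap_mul_pow_three hc
  have hfork : ∀ {d : ℕ}, 3 ≤ d → (forkGen 0 * forkGen d) ^ 2 = 1 := by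
    intro d hd
    rw [forkGen_zero, forkGen_of_ne (by omega)]
    exact forkSwap_mul_adjSwap hd
  by_cases hst : s = t
  · subst hst
    simp [forkGen_mul_self]
  rcases hM s t hst with ⟨m, ⟨h1, h2⟩ | ⟨h1, h2⟩ | ⟨h1, h2⟩ | ⟨h1, h2⟩ | ⟨h1, h2⟩ | ⟨h1, h2⟩⟩ |
    ⟨m, ⟨h1, h2⟩ | ⟨h1, h2⟩ | ⟨h1, h2⟩ | ⟨h1, h2⟩⟩ <;> rw [m]
  · rw [h1, h2]; exact forkSwap_mul_adjSwap_one
  · rw [h1, h2]; exact hsym forkSwap_mul_adjSwap_one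
  · rw [h1]; exact hfork h2
  · rw [h1]; exact hsym (hfork h2)
  · exact hfar h1 h2
  · exact hsym (hfar h1 h2)
  · rw [h1, h2]; exact forkSwap_mul_adjSwap_two
  · rw [h1, h2]; exact hsym forkSwap_mul_adjSwap_two
  · rw [← h2]; exact hnear h1
  · rw [← h2]; exact hsym (hnear h1)

theorem exists_hom_of_isForkNode (hM : IsForkNode M node) (hN2 : 2 ≤ N)
    (hN : ∀ s, node s + 1 ≤ N) :
    ∃ φ : W →* Perm ℤ, (∀ s, φ (cs.simple s) = forkGen (node s)) ∧ (∀ w, φ w ∈ signedPerm N) ∧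
      ∀ w s, cs.IsRightDescent w s ↔ forkValue (φ w) (node s) < 0 := by
  refine ⟨cs.lift ⟨_, isLiftable_forkGen hM⟩, fun s => cs.lift_apply_simple _ s, ?_⟩
  set φ := cs.lift ⟨_, isLiftable_forkGen hM⟩
  have hs : ∀ s, φ (cs.simple s) = forkGen (node s) := fun s => cs.lift_apply_simple _ s
  have hmem : ∀ w, φ w ∈ signedPerm N := mem_of_simple_mem cs fun s => by
    rw [hs]; exact forkGen_mem hN2 (hN s)
  refine ⟨hmem, fun w s => ?_⟩
  refine isRightDescent_iff_neg cs (D := fun w s => forkValue (φ w) (node s))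
    (A := fun t s => if node s = node t then 2 else
      if (1 ≤ node s ∧ node s + 1 = node t) ∨ (1 ≤ node t ∧ node t + 1 = node s) ∨
        (node s = 0 ∧ node t = 2) ∨ (node s = 2 ∧ node t = 0) then -1 else 0) ?_ ?_ ?_ ?_ w s
  · intro s
    simp only [map_one, forkValue, Perm.one_apply]
    split_ifs <;> omega
  · intro w t s
    have hneg := map_neg_of_mem (hmem w)
    simp only [map_mul, hs]
    exact forkValue_mul_forkGen hneg _ _
  · intro s; simp
  · intro s t hst
    rcases hM s t hst with ⟨m, h⟩ | ⟨m, h⟩ <;> simp only [m] <;> grind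

theorem hom_injective {φ : W →* Perm ℤ} (h : ∀ w, φ w = 1 → ∀ s, ¬ cs.IsRightDescent w s) :
    Function.Injective φ := by
  rw [injective_iff_map_eq_one]
  intro w hw
  by_contra hne
  obtain ⟨s, hs⟩ := cs.exists_rightDescent_of_ne_one hne
  exact h w hw s hs

end Hom

/-- The underlying function of `blockPerm`. -/
def blockFun (x y z b : ℕ) (k : ℤ) : ℤ :=
  if k < 0 then
    (if -z ≤ k then k else if -(z + x) ≤ k then k - y - b
      else if -(z + x + b) ≤ k then k + (x + y + 2 * z + b + 1)
      else if -(z + x + b + y) ≤ k then k + x + b else k)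
  else
    (if k ≤ z then k else if k ≤ z + x then k + y + b
      else if k ≤ z + x + b then k - (x + y + 2 * z + b + 1)
      else if k ≤ z + x + b + y then k - x - b else k)

theorem blockFun_blockFun (x y z b : ℕ) (k : ℤ) : blockFun y x z b (blockFun x y z b k) = k := by
  obtain ⟨m, hm⟩ : ∃ m, m = blockFun x y z b k := ⟨_, rfl⟩
  rw [← hm]
  unfold blockFun at hm ⊢
  split_ifs at hm <;> split_ifs <;> omega

/-- The signed permutation with window `1, …, z`, followed by `x` large values, `b` negative
values and `y` small values, each block being increasing. -/
def blockPerm (x y z b : ℕ) : Perm ℤ where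
  toFun := blockFun x y z b
  invFun := blockFun y x z b
  left_inv := blockFun_blockFun x y z b
  right_inv := blockFun_blockFun y x z b

theorem blockPerm_inv (x y z b : ℕ) : (blockPerm x y z b)⁻¹ = blockPerm y x z b := rfl

theorem blockPerm_apply {x y z b : ℕ} {k : ℤ} (hk : 0 ≤ k) : blockPerm x y z b k =
    if k ≤ z then k else if k ≤ z + x then k + y + b
      else if k ≤ z + x + b then k - (x + y + 2 * z + b + 1)
      else if k ≤ z + x + b + y then k - x - b else k := by
  change blockFun x y z b k = _
  rw [blockFun, if_neg (by omega)]

theorem blockPerm_mem {x y z b N : ℕ} (h : x + y + z + b ≤ N) :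
    blockPerm x y z b ∈ signedPerm N := by
  refine ⟨fun k => ?_, fun k hk => ?_⟩
  · change blockFun x y z b (-k) = -blockFun x y z b k
    unfold blockFun
    split_ifs <;> omega
  · rw [blockPerm_apply (by omega)]
    split_ifs <;> omega

theorem blockPerm_lt_iff {x y z b c : ℕ} (hc : c < x + y + z + b) (h : 1 ≤ b ∨ 1 ≤ x ∧ 1 ≤ y) :
    blockPerm x y z b (c + 1) < blockPerm x y z b c ↔ c = x + z := by
  rw [blockPerm_apply (by omega), blockPerm_apply (by omega)]
  split_ifs <;> omega

theorem lt_of_forall_lt_succ {f : ℤ → ℤ} {a b : ℤ} (h : ∀ k, a ≤ k → k < b → f k < f (k + 1))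
    {k l : ℤ} (hk : a ≤ k) (hkl : k < l) (hl : l ≤ b) : f k < f l := by
  have H : ∀ l, k + 1 ≤ l → l ≤ b → f k < f l := by
    intro l hl
    induction l, hl using Int.leInduction with
    | base => exact fun h' => h k hk (by omega)
    | succ l hl ih => exact fun h' => (ih (by omega)).trans (h l (by omega) (by omega))
  exact H l (by omega) hl

theorem exists_threshold {P : ℤ → Prop} {a b : ℤ} (hab : a ≤ b)
    (hP : ∀ k, a < k → k < b → P (k + 1) → P k) :
    ∃ t, a ≤ t ∧ t ≤ b ∧ ∀ k, a < k → k ≤ b → (P k ↔ k ≤ t) := by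
  induction b, hab using Int.leInduction with
  | base => exact ⟨a, le_rfl, le_rfl, fun k h1 h2 => by omega⟩
  | succ b hb ih =>
    obtain ⟨t, h1, h2, h3⟩ := ih fun k hk1 hk2 => hP k hk1 (by omega)
    by_cases hPb : P (b + 1)
    · have hall : ∀ d : ℕ, a < b + 1 - d → P (b + 1 - d) := by
        intro d
        induction d with
        | zero => intro _; simpa using hPb
        | succ d ihd =>
          intro hd
          push_cast at hd ⊢
          exact hP _ (by omega) (by omega) (by convert ihd (by omega) using 1; ring)
      refine ⟨b + 1, by omega, le_rfl, fun k hk1 hk2 => ⟨fun _ => hk2, fun _ => ?_⟩⟩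
      have := hall (b + 1 - k).toNat (by omega)
      rwa [show b + 1 - ((b + 1 - k).toNat : ℤ) = k by omega] at this
    · refine ⟨t, h1, by omega, fun k hk1 hk2 => ?_⟩
      by_cases hkb : k = b + 1
      · subst hkb
        simp only [hPb, false_iff]
        omega
      · exact h3 k hk1 (by omega)

theorem sub_eq_of_lt_of_lt {g v : ℤ → ℤ} {a b p q : ℤ} (hvg : ∀ k, v (g k) = k)
    (hg : ∀ k l, a ≤ k → k < l → l ≤ b → g k < g l)
    (hv : ∀ k l, p ≤ k → k < l → l ≤ q → v k < v l)
    {k l : ℤ} (hk : a ≤ k) (hkl : k ≤ l) (hl : l ≤ b) (hp : p ≤ g k) (hq : g l ≤ q) :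
    g l - g k = l - k := by
  induction l, hkl using Int.leInduction with
  | base => omega
  | succ l hkl ih =>
    have h1 := hg l (l + 1) (by omega) (by omega) hl
    have h2 := ih (by omega) (by omega)
    by_contra hne
    have h3 := hv (g l) (g l + 1) (by omega) (by omega) (by omega)
    have h4 := hv (g l + 1) (g (l + 1)) (by omega) (by omega) (by omega)
    rw [hvg] at h3 h4
    omega

/-- A signed permutation which increases everywhere except at one position, and whose inverse has
the same property, consists of at most four blocks. -/
theorem exists_eq_blockPerm {g : Perm ℤ} {n i j : ℕ} (hg : g ∈ signedPerm n) (hi : i < n)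
    (hj : j < n) (hR : ∀ c : ℕ, c < n → c ≠ j → g c < g (c + 1))
    (hL : ∀ c : ℕ, c < n → c ≠ i → g⁻¹ c < g⁻¹ (c + 1)) (hn : g n ≠ n) :
    ∃ x y z b : ℕ, x + y + z + b = n ∧ x + z = j ∧ y + z = i ∧ g = blockPerm x y z b := by
  have hinv := inv_mem hg
  obtain ⟨v, hv⟩ : ∃ v, v = g⁻¹ := ⟨_, rfl⟩
  rw [← hv] at hL hinv
  have hvg : ∀ k, v (g k) = k := by simp [hv]
  have hgv : ∀ k, g (v k) = k := by simp [hv]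
  have hg0 := map_zero_of_mem hg
  have hv0 := map_zero_of_mem hinv
  have hgneg := map_neg_of_mem hg
  have hvneg := map_neg_of_mem hinv
  have hgle : ∀ k : ℤ, k ≤ n → g k ≤ n := fun k => map_le_of_mem hg
  have hgge : ∀ k : ℤ, -n ≤ k → -n ≤ g k := fun k => neg_le_map_of_mem hg
  have hvle : ∀ k : ℤ, k ≤ n → v k ≤ n := fun k => map_le_of_mem hinv
  have hvge : ∀ k : ℤ, -n ≤ k → -n ≤ v k := fun k => neg_le_map_of_mem hinv
  have hR' : ∀ c : ℤ, 0 ≤ c → c < n → c ≠ j → g c < g (c + 1) := by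
    intro c h1 h2 h3
    lift c to ℕ using h1
    exact hR c (by omega) (by omega)
  have hL' : ∀ c : ℤ, 0 ≤ c → c < n → c ≠ i → v c < v (c + 1) := by
    intro c h1 h2 h3
    lift c to ℕ using h1
    exact hL c (by omega) (by omega)
  have g1 : ∀ k l : ℤ, 0 ≤ k → k < l → l ≤ j → g k < g l := fun k l h1 h2 h3 =>
    lt_of_forall_lt_succ (fun c hc1 hc2 => hR' c (by omega) (by omega) (by omega)) h1 h2 h3
  have g2 : ∀ k l : ℤ, (j : ℤ) + 1 ≤ k → k < l → l ≤ n → g k < g l := fun k l h1 h2 h3 =>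
    lt_of_forall_lt_succ (fun c hc1 hc2 => hR' c (by omega) (by omega) (by omega)) h1 h2 h3
  have v1 : ∀ k l : ℤ, -i ≤ k → k < l → l ≤ i → v k < v l := fun k l h1 h2 h3 => by
    refine lt_of_forall_lt_succ (fun c hc1 hc2 => ?_) h1 h2 h3
    rcases le_or_gt 0 c with h | h
    · exact hL' c h (by omega) (by omega)
    · have := hL' (-c - 1) (by omega) (by omega) (by omega)
      rw [show -c - 1 + 1 = -c by ring, show -c - 1 = -(c + 1) by ring, hvneg, hvneg] at this
      omega
  have v2 : ∀ k l : ℤ, (i : ℤ) + 1 ≤ k → k < l → l ≤ n → v k < v l := fun k l h1 h2 h3 =>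
    lt_of_forall_lt_succ (fun c hc1 hc2 => hL' c (by omega) (by omega) (by omega)) h1 h2 h3
  have v3 : ∀ k l : ℤ, -n ≤ k → k < l → l ≤ -(i + 1 : ℤ) → v k < v l := fun k l h1 h2 h3 => by
    have := v2 (-l) (-k) (by omega) (by omega) (by omega)
    rw [hvneg, hvneg] at this
    omega
  have hpos : ∀ k : ℤ, 0 ≤ k → k ≤ j → k ≤ g k := by
    intro k h1
    induction k, h1 using Int.leInduction with
    | base => simp [hg0]
    | succ k hk ih =>
      intro h
      have := ih (by omega)
      have := g1 k (k + 1) hk (by omega) h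
      omega
  have hlast : ∀ k : ℤ, (j : ℤ) + 1 ≤ k → k ≤ n → g k ≤ i := by
    intro k h1 h2
    by_contra! h
    have h3 : g k ≤ g n := by
      rcases h2.lt_or_eq with h2 | h2
      · exact (g2 k n h1 h2 le_rfl).le
      · rw [h2]
    have h4 := hgle n le_rfl
    have h5 := v2 (g n) n (by omega) (by omega) le_rfl
    rw [hvg] at h5
    have := hvle n le_rfl
    omega
  obtain ⟨z, hz0, hzj, hz⟩ := exists_threshold (P := fun k => g k ≤ i) (a := 0) (b := j)
    (by omega) fun k h1 h2 h3 => (g1 k (k + 1) (by omega) (by omega) (by omega)).le.trans h3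
  obtain ⟨t, htj, htn, ht⟩ := exists_threshold (P := fun k => g k ≤ -(i + 1 : ℤ)) (a := j) (b := n)
    (by omega) fun k h1 h2 h3 => (g2 k (k + 1) (by omega) (by omega) (by omega)).le.trans h3
  have hfix : ∀ k : ℤ, 0 ≤ k → k ≤ z → g k = k := by
    intro k h1 h2
    rcases h1.lt_or_eq with h1 | rfl
    · have h3 := (hz k h1 (by omega)).2 h2
      have := sub_eq_of_lt_of_lt hvg g1 v1 le_rfl h1.le (by omega) (by omega) h3
      omega
    · exact hg0
  have hjn : z < j → g j = n := by
    intro h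
    have h1 : ¬ g j ≤ i := fun h' => by
      have := (hz j (by omega) le_rfl).1 h'
      omega
    by_contra hne
    have h2 := hgle j (by omega)
    have h3 := v2 (g j) n (by omega) (by omega) le_rfl
    rw [hvg] at h3
    have h4 := hlast (v n) (by omega) (hvle n le_rfl)
    rw [hgv] at h4
    omega
  have hlarge : ∀ k : ℤ, z < k → k ≤ j → g k = k + n - j := by
    intro k h1 h2
    have h3 : ¬ g k ≤ i := fun h' => by
      have := (hz k (by omega) h2).1 h'
      omega
    have h4 := hjn (by omega)
    have := sub_eq_of_lt_of_lt hvg g1 v2 (k := k) (l := j) (by omega) h2 le_rfl (by omega)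
      (by omega)
    omega
  have hfirst : j < t → g (j + 1) = -(n - (j - z)) := by
    intro h
    have h1 := (ht (j + 1) (by omega) (by omega)).2 (by omega)
    have h2 := hgge (j + 1) (by omega)
    have h3 : -(n - (j - z)) ≤ g (j + 1) := by
      by_contra! h3
      have h4 := hlarge (-g (j + 1) - n + j) (by omega) (by omega)
      have h5 := hvg (-g (j + 1) - n + j)
      rw [h4, show -g (j + 1) - n + j + n - j = -g (j + 1) by ring, hvneg, hvg] at h5
      omega
    by_contra hne
    have h4 := v3 (-(n - (j - z))) (g (j + 1)) (by omega) (by omega) (by omega)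
    rw [hvg] at h4
    have h5 := hgv (-(n - (j - z)))
    have h8 := hvge (-(n - (j - z))) (by omega)
    generalize v (-(n - (j - z))) = p at h4 h5 h8
    rcases le_or_gt 0 p with hp | hp
    · have := hpos p hp (by omega)
      omega
    · have h6 := hgneg p
      rw [h5] at h6
      rcases le_or_gt (-p) z with h7 | h7
      · have := hfix (-p) (by omega) h7
        omega
      rcases le_or_gt (-p) j with h9 | h9
      · have := hlarge (-p) h7 h9
        omega
      · have := hlast (-p) (by omega) (by omega)
        omega
  have hnegative : ∀ k : ℤ, j < k → k ≤ t → g k = k - j - 1 - (n - (j - z)) := by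
    intro k h1 h2
    have h3 := hfirst (by omega)
    have h4 := (ht k h1 (by omega)).2 h2
    have h5 := hgge (j + 1) (by omega)
    have := sub_eq_of_lt_of_lt hvg g2 v3 (k := j + 1) (l := k) le_rfl (by omega) (by omega) h5 h4
    omega
  have hmid : ∀ k : ℤ, t < k → k ≤ n → -i ≤ g k := by
    intro k h1 h2
    by_contra! h
    have := (ht k (by omega) h2).1 (by omega)
    omega
  have hni : t < n → g n = i := by
    intro h
    by_contra hne
    have h1 := hlast n (by omega) le_rfl
    have h2 := v1 (g n) i (hmid n h le_rfl) (by omega) le_rfl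
    rw [hvg] at h2
    have := hvle i (by omega)
    omega
  have hsmall : ∀ k : ℤ, t < k → k ≤ n → g k = k - n + i := by
    intro k h1 h2
    have h3 := hni (by omega)
    have h4 := hmid k h1 h2
    have := sub_eq_of_lt_of_lt hvg g2 v1 (k := k) (l := n) (by omega) h2 le_rfl h4 (by omega)
    omega
  have hzi : z ≤ i := by
    rcases hz0.lt_or_eq with h | h
    · have h1 := hfix z h.le le_rfl
      have := (hz z h hzj).2 le_rfl
      omega
    · omega
  have hvz : v z = z := by
    have := hvg z
    rwa [hfix z hz0 le_rfl] at this
  have hvmid : ∀ m : ℤ, z < m → m ≤ i → t < v m := by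
    intro m h1 h2
    have h3 := v1 z m (by omega) h1 h2
    have h4 := hvle m (by omega)
    have h5 := hgv m
    rw [hvz] at h3
    by_contra! h6
    rcases le_or_gt (v m) j with h7 | h7
    · have := (hz (v m) (by omega) h7).1 (by omega)
      omega
    · have := hnegative (v m) h7 h6
      omega
  have hcount : i = n - t + z := by
    rcases htn.lt_or_eq with h | h
    · have h1 := hsmall (t + 1) (by omega) (by omega)
      have h2 : z < g (t + 1) := by
        by_contra! h2
        rcases h2.lt_or_eq with h2 | h2
        · have := v1 (g (t + 1)) z (hmid _ (by omega) (by omega)) h2 hzi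
          rw [hvg, hvz] at this
          omega
        · have := hvg (t + 1)
          rw [h2, hvz] at this
          omega
      by_contra hne
      have h3 := v1 (z + 1) (g (t + 1)) (by omega) (by omega) (by omega)
      have h4 := hvmid (z + 1) (by omega) (by omega)
      rw [hvg] at h3
      omega
    · by_contra hne
      have h1 := hvmid i (by omega) le_rfl
      have := hvle i (by omega)
      omega
  lift z to ℕ using hz0
  lift t to ℕ using by omega
  refine ⟨j - z, n - t, z, t - j, by omega, by omega, by omega, ?_⟩
  refine ext_of_mem hg (blockPerm_mem (by omega)) fun k hk1 hk2 => ?_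
  rw [blockPerm_apply (by omega)]
  split_ifs
  · exact hfix k (by omega) (by omega)
  · rw [hlarge k (by omega) (by omega)]; omega
  · rw [hnegative k (by omega) (by omega)]; omega
  · rw [hsmall k (by omega) (by omega)]; omega
  · omega

/-- `g` maps the integers larger than `c` to the integers larger than `c`. -/
def PreservesAbove (c : ℕ) (g : Perm ℤ) : Prop := ∀ k : ℤ, (c : ℤ) < k ↔ (c : ℤ) < g k

section PreservesAbove
variable {N c d : ℕ} {g h : Perm ℤ}

theorem preservesAbove_one (c : ℕ) : PreservesAbove c 1 := fun _ => Iff.rfl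

theorem PreservesAbove.mul (hg : PreservesAbove c g) (hh : PreservesAbove c h) :
    PreservesAbove c (g * h) := fun k => (hh k).trans (hg (h k))

theorem PreservesAbove.inv (hg : PreservesAbove c g) : PreservesAbove c g⁻¹ := fun k => by
  simpa using (hg (g⁻¹ k)).symm

theorem preservesAbove_signFlip (hc : 1 ≤ c) : PreservesAbove c signFlip := by
  intro k
  rw [signFlip_apply]
  split_ifs <;> omega

theorem preservesAbove_adjSwap (h : c ≠ d) : PreservesAbove c (adjSwap d) := by
  intro k
  rcases Nat.eq_zero_or_pos d with rfl | hd
  · rw [adjSwap_zero]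
    exact preservesAbove_signFlip (by omega) k
  · rw [adjSwap_apply hd]
    split_ifs <;> omega

theorem preservesAbove_forkSwap (hc : 2 ≤ c) : PreservesAbove c forkSwap := by
  intro k
  rw [forkSwap_apply]
  split_ifs <;> omega

theorem PreservesAbove.le (hg : PreservesAbove c g) : g c ≤ g (c + 1) := by
  have h1 := hg c
  have h2 := hg (c + 1)
  omega

theorem preservesAbove_zero (hg : g ∈ signedPerm N)
    (h : ∀ k : ℤ, 0 < k → k ≤ N → 0 < g k) : PreservesAbove 0 g := by
  have hpos : ∀ k : ℤ, 0 < k → 0 < g k := fun k hk => by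
    by_cases hkN : k ≤ N
    · exact h k hk hkN
    · rw [map_of_lt_of_mem hg (by omega)]; exact hk
  intro k
  simp only [Nat.cast_zero]
  refine ⟨hpos k, fun hk => ?_⟩
  rcases lt_trichotomy k 0 with h1 | rfl | h1
  · have := hpos (-k) (by omega)
    rw [map_neg_of_mem hg] at this
    omega
  · rw [map_zero_of_mem hg] at hk
    omega
  · exact h1

theorem preservesAbove_of_map_eq (hg : g ∈ signedPerm N) (hN : 1 ≤ N) (h : g N = N) :
    PreservesAbove (N - 1) g := by
  have key : ∀ f : Perm ℤ, f ∈ signedPerm N → f N = N → ∀ k : ℤ, ((N - 1 : ℕ) : ℤ) < k →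
      ((N - 1 : ℕ) : ℤ) < f k := by
    intro f hf hfN k hk
    rcases (show (N : ℤ) ≤ k by omega).lt_or_eq with h1 | rfl
    · rw [map_of_lt_of_mem hf h1]; exact hk
    · rw [hfN]; exact hk
  intro k
  refine ⟨key g hg h k, fun hk => ?_⟩
  have := key g⁻¹ (inv_mem hg) (by rw [Perm.inv_eq_iff_eq, h]) (g k) hk
  simpa using this

theorem exists_map_eq_of_preservesAbove {G : Type*} [Group G] {φ : G →* Perm ℤ}
    (hφ : ∀ c : ℕ, 1 ≤ c → c + 1 ≤ N → ∃ w, φ w = adjSwap c) (hg : g ∈ signedPerm N)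
    (hpos : PreservesAbove 0 g) : ∃ w, φ w = g := by
  obtain ⟨w, hw⟩ := exists_mul_of_weight_lt (N := N) φ
    (C := fun g => g ∈ signedPerm N ∧ PreservesAbove 0 g) (Z := fun g => g = 1)
    (fun g hg => hg.1) (fun g ⟨hg, hpos⟩ => by
      by_cases H : ∀ c : ℕ, c < N → g c < g (c + 1)
      · exact Or.inl (eq_one_of_strictMono hg H)
      · push Not at H
        obtain ⟨c, hcN, hc⟩ := H
        have hne : g (c + 1) ≠ g c := fun h => by simpa using g.injective h
        have hc1 : 1 ≤ c := by
          by_contra h0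
          obtain rfl : c = 0 := by omega
          exact hne (hc.antisymm hpos.le)
        obtain ⟨w, hw⟩ := hφ c hc1 hcN
        refine Or.inr ⟨w, ?_⟩
        rw [hw]
        exact ⟨⟨mul_mem hg (adjSwap_mem hcN), hpos.mul (preservesAbove_adjSwap (by omega))⟩,
          weight_lt_mul_adjSwap hc1 hcN (lt_of_le_of_ne hc hne)⟩) ⟨hg, hpos⟩
  exact ⟨w⁻¹, by rw [map_inv]; exact (eq_inv_of_mul_eq_one_left hw).symm⟩

theorem exists_map_eq_of_mem {G : Type*} [Group G] {φ : G →* Perm ℤ}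
    (hφ : ∀ c : ℕ, c + 1 ≤ N → ∃ w, φ w = adjSwap c) (hg : g ∈ signedPerm N) :
    ∃ w, φ w = g := by
  obtain ⟨w, hw⟩ := exists_mul_of_weight_lt (N := N) φ
    (C := fun g => g ∈ signedPerm N) (Z := fun g => g = 1) (fun g hg => hg) (fun g hg => by
      by_cases H : ∀ c : ℕ, c < N → g c < g (c + 1)
      · exact Or.inl (eq_one_of_strictMono hg H)
      · push Not at H
        obtain ⟨c, hcN, hc⟩ := H
        have hne : g (c + 1) ≠ g c := fun h => by simpa using g.injective h
        obtain ⟨w, hw⟩ := hφ c hcN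
        refine Or.inr ⟨w, ?_⟩
        rw [hw]
        refine ⟨mul_mem hg (adjSwap_mem hcN), ?_⟩
        rcases Nat.eq_zero_or_pos c with rfl | hc1
        · have h0 := map_zero_of_mem hg
          simp only [Nat.cast_zero, zero_add, h0] at hc hne
          rw [adjSwap_zero]
          exact weight_lt_mul_signFlip hcN hg (lt_of_le_of_ne hc hne)
        · exact weight_lt_mul_adjSwap hc1 hcN (lt_of_le_of_ne hc hne)) hg
  exact ⟨w⁻¹, by rw [map_inv]; exact (eq_inv_of_mul_eq_one_left hw).symm⟩

end PreservesAbove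

theorem existsUnique_node_iff {node : B → ℕ} {P : ℕ → Prop} {lo N : ℕ}
    (hinj : Function.Injective node) (hnode : ∀ c, (∃ s, node s = c) ↔ lo ≤ c ∧ c < N) :
    (∃! s, P (node s)) ↔ ∃ j, lo ≤ j ∧ j < N ∧ ∀ c, lo ≤ c → c < N → (P c ↔ c = j) := by
  constructor
  · rintro ⟨s, hs, hu⟩
    obtain ⟨h1, h2⟩ := (hnode _).1 ⟨s, rfl⟩
    refine ⟨node s, h1, h2, fun c h3 h4 => ⟨fun hc => ?_, fun hc => hc ▸ hs⟩⟩
    obtain ⟨t, rfl⟩ := (hnode c).2 ⟨h3, h4⟩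
    rw [hu t hc]
  · rintro ⟨j, h1, h2, hj⟩
    obtain ⟨s, rfl⟩ := (hnode j).2 ⟨h1, h2⟩
    refine ⟨s, (hj _ h1 h2).2 rfl, fun t ht => ?_⟩
    obtain ⟨h3, h4⟩ := (hnode _).1 ⟨t, rfl⟩
    exact hinj ((hj _ h3 h4).1 ht)

theorem bigrassmannian_iff (cs : CoxeterSystem M W) {φ : W →* Perm ℤ} {node : B → ℕ}
    {P : Perm ℤ → ℕ → Prop} {lo N : ℕ} (hdesc : ∀ w s, cs.IsRightDescent w s ↔ P (φ w) (node s))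
    (hinj : Function.Injective node) (hnode : ∀ c, (∃ s, node s = c) ↔ lo ≤ c ∧ c < N) (w : W) :
    Bigrassmannian cs w ↔
      (∃ i, lo ≤ i ∧ i < N ∧ ∀ c, lo ≤ c → c < N → (P (φ w)⁻¹ c ↔ c = i)) ∧
      ∃ j, lo ≤ j ∧ j < N ∧ ∀ c, lo ≤ c → c < N → (P (φ w) c ↔ c = j) := by
  rw [Bigrassmannian, ← existsUnique_node_iff hinj hnode, ← existsUnique_node_iff hinj hnode]
  simp only [← cs.isRightDescent_inv_iff, hdesc, map_inv]

theorem supp_eq_univ_iff (cs : CoxeterSystem M W) {node : B → ℕ} {Q : ℕ → Prop} {lo N : ℕ}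
    {w : W} (hsupp : ∀ s, s ∈ Supp cs w ↔ Q (node s))
    (hnode : ∀ c, (∃ s, node s = c) ↔ lo ≤ c ∧ c < N) :
    Supp cs w = Set.univ ↔ ∀ c, lo ≤ c → c < N → Q c := by
  rw [Set.eq_univ_iff_forall]
  constructor
  · intro h c h1 h2
    obtain ⟨s, rfl⟩ := (hnode c).2 ⟨h1, h2⟩
    exact (hsupp s).1 (h s)
  · intro h s
    obtain ⟨h1, h2⟩ := (hnode _).1 ⟨s, rfl⟩
    exact (hsupp s).2 (h _ h1 h2)

section Chain
variable (cs : CoxeterSystem M W) {node : B → ℕ} {N : ℕ} {φ : W →* Perm ℤ}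

theorem IsChainNode.injective (hM : IsChainNode M node) : Function.Injective node := by
  intro s t h
  by_contra hst
  have := hM s t hst
  omega

theorem mem_supp_iff_of_isChainNode (hM : IsChainNode M node)
    (hs : ∀ s, φ (cs.simple s) = adjSwap (node s))
    (hdesc : ∀ w s, cs.IsRightDescent w s ↔ φ w (node s + 1) < φ w (node s)) (w : W) (s : B) :
    s ∈ Supp cs w ↔ ¬ PreservesAbove (node s) (φ w) := by
  refine mem_supp_iff_of_invariant cs s (fun w => PreservesAbove (node s) (φ w)) ?_ ?_ ?_ w
  · rw [map_one]; exact preservesAbove_one _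
  · intro w t hts h
    rw [map_mul, hs]
    exact h.mul (preservesAbove_adjSwap fun h => hts (hM.injective h.symm))
  · intro w h
    rw [hdesc]
    exact not_lt.2 h.le

theorem injective_of_isRightDescent_iff
    (hdesc : ∀ w s, cs.IsRightDescent w s ↔ φ w (node s + 1) < φ w (node s)) :
    Function.Injective φ :=
  hom_injective cs fun w hw s => by
    rw [hdesc, hw]
    simp

end Chain

theorem not_preservesAbove_blockPerm {x y z b c : ℕ} (hb : 1 ≤ b) (hc : c < x + y + z + b) :
    ¬ PreservesAbove c (blockPerm x y z b) := by
  intro h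
  rcases le_or_gt c (z + x) with h1 | h1
  · have := (h (z + x + 1)).1 (by omega)
    rw [blockPerm_apply (by omega)] at this
    split_ifs at this <;> omega
  · have := (h (c + 1)).1 (by omega)
    rw [blockPerm_apply (by omega)] at this
    split_ifs at this <;> omega

theorem blockPerm_inj {x y z b x' y' z' b' : ℕ} (hb : 1 ≤ b) (hb' : 1 ≤ b')
    (hsum : x + y + z + b = x' + y' + z' + b')
    (h : blockPerm x y z b = blockPerm x' y' z' b') : x = x' ∧ y = y' ∧ z = z' ∧ b = b' := by
  have h1 := (blockPerm_lt_iff (x := x) (y := y) (z := z) (b := b) (c := x + z) (by omega)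
    (Or.inl hb)).2 rfl
  rw [h, blockPerm_lt_iff (by omega) (Or.inl hb')] at h1
  have h2 := (blockPerm_lt_iff (x := y) (y := x) (z := z) (b := b) (c := y + z) (by omega)
    (Or.inl hb)).2 rfl
  rw [← blockPerm_inv, h, blockPerm_inv, blockPerm_lt_iff (by omega) (Or.inl hb')] at h2
  have h3 := DFunLike.congr_fun h (z + x + 1 : ℤ)
  rw [blockPerm_apply (by omega), blockPerm_apply (by omega)] at h3
  split_ifs at h3 <;> omega

/-- The pairs `(s, t)` with `t ≤ s < m`. -/
def triangle (m : ℕ) : Finset (Σ _ : ℕ, ℕ) := (Finset.range m).sigma fun s => Finset.range (s + 1)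

/-- The triples `(s, t, u)` with `u ≤ t ≤ s < m`. -/
def tetrahedron (m : ℕ) : Finset (Σ _ : ℕ, Σ _ : ℕ, ℕ) :=
  (Finset.range m).sigma fun s => triangle (s + 1)

theorem mem_triangle {m : ℕ} {p : Σ _ : ℕ, ℕ} : p ∈ triangle m ↔ p.1 < m ∧ p.2 ≤ p.1 := by
  simp only [triangle, Finset.mem_sigma, Finset.mem_range]
  omega

theorem mem_tetrahedron {m : ℕ} {p : Σ _ : ℕ, Σ _ : ℕ, ℕ} :
    p ∈ tetrahedron m ↔ p.1 < m ∧ p.2.1 ≤ p.1 ∧ p.2.2 ≤ p.2.1 := by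
  simp only [tetrahedron, Finset.mem_sigma, mem_triangle, Finset.mem_range]
  omega

theorem card_triangle (m : ℕ) : (triangle m).card * 2 = m * (m + 1) := by
  simp only [triangle, Finset.card_sigma, Finset.card_range]
  induction m with
  | zero => simp
  | succ m ih => rw [Finset.sum_range_succ, add_mul, ih]; ring

theorem card_tetrahedron (m : ℕ) : (tetrahedron m).card * 6 = m * (m + 1) * (m + 2) := by
  simp only [tetrahedron, Finset.card_sigma]
  induction m with
  | zero => simp
  | succ m ih =>
    rw [Finset.sum_range_succ]
    linarith [card_triangle (m + 1)]

theorem card_typeB {n : ℕ} (hn : 2 ≤ n) (cs : CoxeterSystem M W) {node : B → ℕ}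
    (hM : IsChainNode M node) (hnode : ∀ c, (∃ s, node s = c) ↔ 0 ≤ c ∧ c < n) :
    Nat.card {w : W // Bigrassmannian cs w ∧ Supp cs w = Set.univ} = n * (n + 1) * (n + 2) / 6 := by
  obtain ⟨φ, hs, hmem, hdesc⟩ := exists_hom_of_isChainNode cs hM (N := n)
    fun s => ((hnode _).1 ⟨s, rfl⟩).2
  have hφ := injective_of_isRightDescent_iff cs hdesc
  let f : (Σ _ : ℕ, Σ _ : ℕ, ℕ) → Perm ℤ :=
    fun p => blockPerm p.2.2 (p.2.1 - p.2.2) (p.1 - p.2.1) (n - p.1)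
  have himage : φ '' {w | Bigrassmannian cs w ∧ Supp cs w = Set.univ} = f '' tetrahedron n := by
    ext g
    simp only [Set.mem_image, Set.mem_ofPred_eq, Finset.mem_coe, mem_tetrahedron]
    constructor
    · rintro ⟨w, ⟨hw, hfull⟩, rfl⟩
      rw [bigrassmannian_iff cs (P := fun g c => g (c + 1) < g c) hdesc hM.injective hnode] at hw
      obtain ⟨⟨i, -, hi, hL⟩, j, -, hj, hR⟩ := hw
      rw [supp_eq_univ_iff cs (Q := fun c => ¬ PreservesAbove c (φ w))
          (mem_supp_iff_of_isChainNode cs hM hs hdesc w) hnode] at hfull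
      have hlt : ∀ (g : Perm ℤ) (c : ℕ), ¬ g (c + 1) < g c → g c < g (c + 1) := fun g c h =>
        lt_of_le_of_ne (not_lt.1 h) fun h => by simpa using g.injective h
      obtain ⟨x, y, z, b, hsum, -, -, hE⟩ := exists_eq_blockPerm (hmem w) hi hj
        (fun c hc hne => hlt _ _ fun h => hne ((hR c (Nat.zero_le c) hc).1 h))
        (fun c hc hne => hlt _ _ fun h => hne ((hL c (Nat.zero_le c) hc).1 h))
        (fun h => hfull (n - 1) (Nat.zero_le _) (by omega)
          (preservesAbove_of_map_eq (hmem w) (by omega) h))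
      have hb : 1 ≤ b := by
        by_contra hb
        refine hfull 0 le_rfl (by omega) (preservesAbove_zero (hmem w) fun k hk hkn => ?_)
        rw [hE, blockPerm_apply hk.le]
        split_ifs <;> omega
      refine ⟨⟨x + y + z, x + y, x⟩, ⟨?_, ?_, ?_⟩, ?_⟩
      · simp only; omega
      · simp only; omega
      · simp only; omega
      · rw [hE]
        simp only [f]
        congr 1 <;> omega
    · rintro ⟨⟨s, t, x⟩, ⟨h1, h2, h3⟩, rfl⟩
      simp only at h1 h2 h3
      obtain ⟨y, rfl⟩ := Nat.exists_eq_add_of_le h3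
      obtain ⟨z, rfl⟩ := Nat.exists_eq_add_of_le h2
      obtain ⟨b, rfl⟩ := Nat.exists_eq_add_of_le h1.le
      simp only [f, Nat.add_sub_cancel_left]
      obtain ⟨w, hw⟩ := exists_map_eq_of_mem (φ := φ) (N := x + y + z + b) (fun c hc => by
        obtain ⟨s, rfl⟩ := (hnode c).2 ⟨Nat.zero_le _, hc⟩
        exact ⟨_, hs s⟩) (blockPerm_mem (x := x) (y := y) (z := z) (b := b) le_rfl)
      refine ⟨w, ⟨?_, ?_⟩, hw⟩
      · rw [bigrassmannian_iff cs (P := fun g c => g (c + 1) < g c) hdesc hM.injective hnode, hw,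
          blockPerm_inv]
        exact ⟨⟨y + z, Nat.zero_le _, by omega, fun c _ hc =>
            blockPerm_lt_iff (by omega) (Or.inl (by omega))⟩,
          x + z, Nat.zero_le _, by omega, fun c _ hc =>
            blockPerm_lt_iff (by omega) (Or.inl (by omega))⟩
      · rw [supp_eq_univ_iff cs (Q := fun c => ¬ PreservesAbove c (φ w))
          (mem_supp_iff_of_isChainNode cs hM hs hdesc w) hnode, hw]
        exact fun c _ hc => not_preservesAbove_blockPerm (by omega) hc
  have hf : Set.InjOn f (tetrahedron n) := by
    rintro ⟨s, t, x⟩ h ⟨s', t', x'⟩ h' hff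
    rw [Finset.mem_coe, mem_tetrahedron] at h h'
    dsimp only [f] at h h' hff
    obtain ⟨h1, h2, h3, h4⟩ := blockPerm_inj (by omega) (by omega) (by omega) hff
    obtain rfl : x = x' := h1
    obtain rfl : t = t' := by omega
    obtain rfl : s = s' := by omega
    rfl
  change Nat.card ↥{w | Bigrassmannian cs w ∧ Supp cs w = Set.univ} = _
  rw [Nat.card_coe_set_eq, ← Set.ncard_image_of_injective _ hφ, himage,
    hf.ncard_image, Set.ncard_coe_finset]
  exact (Nat.div_eq_of_eq_mul_left (by norm_num) (card_tetrahedron n).symm).symm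

theorem card_typeA {n : ℕ} (hn : 2 ≤ n) (cs : CoxeterSystem M W) {node : B → ℕ}
    (hM : IsChainNode M node) (hnode : ∀ c, (∃ s, node s = c) ↔ 1 ≤ c ∧ c < n + 1) :
    Nat.card {w : W // Bigrassmannian cs w ∧ Supp cs w = Set.univ} = n := by
  obtain ⟨φ, hs, hmem, hdesc⟩ := exists_hom_of_isChainNode cs hM (N := n + 1)
    fun s => ((hnode _).1 ⟨s, rfl⟩).2
  have hφ := injective_of_isRightDescent_iff cs hdesc
  have hpos : ∀ w, PreservesAbove 0 (φ w) := by
    intro w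
    induction w using cs.simple_induction_left with
    | one => rw [map_one]; exact preservesAbove_one 0
    | mul_simple_left w s ih =>
      rw [map_mul, hs]
      exact (preservesAbove_adjSwap (by have := (hnode _).1 ⟨s, rfl⟩; omega)).mul ih
  let f : ℕ → Perm ℤ := fun t => blockPerm (t + 1) (n - t) 0 0
  have himage : φ '' {w | Bigrassmannian cs w ∧ Supp cs w = Set.univ} = f '' Finset.range n := by
    ext g
    simp only [Set.mem_image, Set.mem_ofPred_eq, Finset.mem_coe, Finset.mem_range]
    constructor
    · rintro ⟨w, ⟨hw, hfull⟩, rfl⟩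
      rw [bigrassmannian_iff cs (P := fun g c => g (c + 1) < g c) hdesc hM.injective hnode] at hw
      obtain ⟨⟨i, hi1, hi, hL⟩, j, hj1, hj, hR⟩ := hw
      rw [supp_eq_univ_iff cs (Q := fun c => ¬ PreservesAbove c (φ w))
          (mem_supp_iff_of_isChainNode cs hM hs hdesc w) hnode] at hfull
      have hlt : ∀ (g : Perm ℤ) (c i : ℕ), PreservesAbove 0 g → c < n + 1 → c ≠ i →
          (∀ c : ℕ, 1 ≤ c → c < n + 1 → (g (c + 1) < g c ↔ c = i)) → g c < g (c + 1) := by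
        intro g c i hg hc hne H
        refine lt_of_le_of_ne ?_ fun h => by simpa using g.injective h
        rcases Nat.eq_zero_or_pos c with rfl | h
        · exact hg.le
        · exact not_lt.1 fun h' => hne ((H c h hc).1 h')
      obtain ⟨x, y, z, b, hsum, hxz, hyz, hE⟩ := exists_eq_blockPerm (hmem w) hi hj
        (fun c hc hne => hlt _ c j (hpos w) hc hne hR)
        (fun c hc hne => hlt _ c i (hpos w).inv hc hne hL)
        (fun h => hfull n (by omega) (by omega)
          (preservesAbove_of_map_eq (hmem w) (by omega) h))
      have hb : b = 0 := by
        by_contra hb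
        have := (hpos w (z + x + 1)).1 (by omega)
        rw [hE, blockPerm_apply (by omega)] at this
        split_ifs at this <;> omega
      have hz : z = 0 := by
        by_contra hz
        have h1 : φ w 1 = 1 := by
          rw [hE, blockPerm_apply (by omega), if_pos (by omega)]
        refine hfull 1 le_rfl (by omega) fun k => ?_
        have h2 := hpos w k
        have h3 : φ w k = 1 ↔ k = 1 := by
          rw [← (φ w).injective.eq_iff (a := k) (b := 1), h1]
        omega
      subst hb hz
      refine ⟨x - 1, by omega, ?_⟩
      rw [hE]
      simp only [f]
      congr 1 <;> omega
    · rintro ⟨t, ht, rfl⟩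
      obtain ⟨y, rfl⟩ := Nat.exists_eq_add_of_le ht.le
      simp only [f, Nat.add_sub_cancel_left]
      have hE := blockPerm_mem (x := t + 1) (y := y) (z := 0) (b := 0) (N := t + y + 1) (by omega)
      obtain ⟨w, hw⟩ := exists_map_eq_of_preservesAbove (φ := φ) (fun c hc1 hc => by
        obtain ⟨s, rfl⟩ := (hnode c).2 ⟨hc1, hc⟩
        exact ⟨_, hs s⟩) hE (preservesAbove_zero hE fun k hk hkn => by
          rw [blockPerm_apply hk.le]
          split_ifs <;> omega)
      refine ⟨w, ⟨?_, ?_⟩, hw⟩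
      · rw [bigrassmannian_iff cs (P := fun g c => g (c + 1) < g c) hdesc hM.injective hnode, hw,
          blockPerm_inv]
        exact ⟨⟨y, by omega, by omega, fun c _ hc =>
            blockPerm_lt_iff (by omega) (Or.inr (by omega))⟩,
          t + 1, by omega, by omega, fun c _ hc =>
            blockPerm_lt_iff (by omega) (Or.inr (by omega))⟩
      · rw [supp_eq_univ_iff cs (Q := fun c => ¬ PreservesAbove c (φ w))
          (mem_supp_iff_of_isChainNode cs hM hs hdesc w) hnode, hw]
        intro c hc1 hc h
        rcases le_or_gt c (t + 1) with h1 | h1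
        · have := (h (t + 2)).1 (by omega)
          rw [blockPerm_apply (by omega)] at this
          split_ifs at this <;> omega
        · have := (h (c + 1)).1 (by omega)
          rw [blockPerm_apply (by omega)] at this
          split_ifs at this <;> omega
  have hf : Set.InjOn f (Finset.range n) := by
    intro t ht t' ht' hff
    have h1 := DFunLike.congr_fun hff 1
    simp only [Finset.coe_range, Set.mem_Iio] at ht ht'
    simp only [f] at h1
    rw [blockPerm_apply (by omega), blockPerm_apply (by omega)] at h1
    split_ifs at h1 <;> omega
  change Nat.card ↥{w | Bigrassmannian cs w ∧ Supp cs w = Set.univ} = _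
  rw [Nat.card_coe_set_eq, ← Set.ncard_image_of_injective _ hφ, himage,
    hf.ncard_image, Set.ncard_coe_finset, Finset.card_range]

theorem signFlip_inv : signFlip⁻¹ = signFlip := inv_eq_of_mul_eq_one_left signFlip_mul_self

theorem mul_signFlip_mul_signFlip (g : Perm ℤ) : g * signFlip * signFlip = g := by
  rw [mul_assoc, signFlip_mul_self, mul_one]

theorem signFlip_mul_signFlip_mul (g : Perm ℤ) : signFlip * (signFlip * g) = g := by
  rw [← mul_assoc, signFlip_mul_self, one_mul]

theorem signFlip_lt_iff {a b : ℤ} (h : a ≠ -b) (ha : a ≠ 0) (hb : b ≠ 0) :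
    signFlip a < signFlip b ↔ a < b := by
  simp only [signFlip_apply]
  split_ifs <;> omega

theorem signFlip_abs (a : ℤ) : |signFlip a| = |a| := by
  rw [signFlip_apply]
  split_ifs with h1 h2
  · rw [h1, abs_neg]
  · rw [h2, abs_neg]
  · rfl

/-- `g` has exactly one descent of type `D`. -/
def UniqueForkDescent (n : ℕ) (g : Perm ℤ) : Prop :=
  ∃ j, 0 ≤ j ∧ j < n ∧ ∀ c, 0 ≤ c → c < n → (forkValue g c < 0 ↔ c = j)

/-- None of the four elements obtained from `g` by changing the sign of the first entry and of the
entry with absolute value one preserves the signs. -/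
def SignMixing (g : Perm ℤ) : Prop :=
  ¬ PreservesAbove 0 g ∧ ¬ PreservesAbove 0 (g * signFlip) ∧ ¬ PreservesAbove 0 (signFlip * g) ∧
    ¬ PreservesAbove 0 (signFlip * g * signFlip)

/-- The condition on a signed permutation characterizing the bigrassmannian elements of full
support in type `D`, up to multiplication by `signFlip`. -/
structure IsForkFull (n : ℕ) (g : Perm ℤ) : Prop where
  mem : g ∈ signedPerm n
  left : UniqueForkDescent n g⁻¹
  right : UniqueForkDescent n g
  mixing : SignMixing g
  above : ∀ c : ℕ, 2 ≤ c → c < n → ¬ PreservesAbove c g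

section Fork
variable {n : ℕ} {g : Perm ℤ}

theorem forkValue_ne_zero (hg : g ∈ signedPerm n) (c : ℕ) : forkValue g c ≠ 0 := by
  intro h
  rcases Nat.eq_zero_or_pos c with rfl | hc
  · rw [forkValue_zero] at h
    have := g.injective ((map_neg_of_mem hg 1).trans (by omega : -g 1 = g 2))
    omega
  · rw [forkValue_of_ne g hc, sub_eq_zero] at h
    have := g.injective h
    omega

theorem forkValue_signFlip_mul (hg : g ∈ signedPerm n) (c : ℕ) :
    forkValue (signFlip * g) c < 0 ↔ forkValue g c < 0 := by
  rcases Nat.eq_zero_or_pos c with rfl | hc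
  · have h := signFlip_lt_iff (a := g 2) (b := -g 1)
      (fun h => by have := g.injective (h.trans (neg_neg _)); omega)
      (map_pos_ne_zero hg two_ne_zero) (neg_ne_zero.2 (map_pos_ne_zero hg one_ne_zero))
    rw [signFlip_neg] at h
    simp only [forkValue_zero, Perm.mul_apply]
    omega
  · rw [forkValue_of_ne _ hc, forkValue_of_ne _ hc, sub_neg, sub_neg]
    refine signFlip_lt_iff (fun h => ?_) (map_pos_ne_zero hg (by omega))
      (map_pos_ne_zero hg (by omega))
    rw [← map_neg_of_mem hg] at h
    have := g.injective h
    omega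

theorem forkValue_mul_signFlip (hg : g ∈ signedPerm n) (c : ℕ) :
    forkValue (g * signFlip) c = forkValue g (swap 0 1 c) := by
  have hneg := map_neg_of_mem hg 1
  rw [swap_apply_def]
  split_ifs with h1 h2
  · subst h1
    rw [forkValue_zero, forkValue_of_ne _ le_rfl, Perm.mul_apply, Perm.mul_apply, signFlip_one,
      signFlip_of_ne (by norm_num) (by norm_num), hneg]
    norm_num
    ring
  · subst h2
    rw [forkValue_zero, forkValue_of_ne _ le_rfl, Perm.mul_apply, Perm.mul_apply, Nat.cast_one,
      signFlip_one, signFlip_of_ne (by norm_num) (by norm_num), hneg]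
    norm_num
    ring
  · rw [forkValue_of_ne _ (by omega), forkValue_of_ne _ (by omega), Perm.mul_apply, Perm.mul_apply,
      signFlip_of_ne (by omega) (by omega), signFlip_of_ne (by omega) (by omega)]

theorem UniqueForkDescent.signFlip_mul (hg : g ∈ signedPerm n) (h : UniqueForkDescent n g) :
    UniqueForkDescent n (signFlip * g) := by
  simpa only [UniqueForkDescent, forkValue_signFlip_mul hg] using h

theorem UniqueForkDescent.mul_signFlip (hn : 2 ≤ n) (hg : g ∈ signedPerm n)
    (h : UniqueForkDescent n g) : UniqueForkDescent n (g * signFlip) := by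
  have hlt : ∀ c, c < n → swap 0 1 c < n := fun c hc => by
    rw [swap_apply_def]
    split_ifs <;> omega
  obtain ⟨j, -, hj, H⟩ := h
  refine ⟨swap 0 1 j, Nat.zero_le _, hlt j hj, fun c _ hc => ?_⟩
  rw [forkValue_mul_signFlip hg, H _ (Nat.zero_le _) (hlt c hc), ← Equiv.eq_symm_apply,
    symm_swap]

theorem SignMixing.signFlip_mul (h : SignMixing g) : SignMixing (signFlip * g) := by
  obtain ⟨h1, h2, h3, h4⟩ := h
  refine ⟨h3, h4, ?_, ?_⟩
  · rwa [signFlip_mul_signFlip_mul]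
  · rwa [signFlip_mul_signFlip_mul]

theorem SignMixing.mul_signFlip (h : SignMixing g) : SignMixing (g * signFlip) := by
  obtain ⟨h1, h2, h3, h4⟩ := h
  refine ⟨h2, ?_, ?_, ?_⟩
  · rwa [mul_signFlip_mul_signFlip]
  · rwa [← mul_assoc]
  · rwa [← mul_assoc, mul_signFlip_mul_signFlip]

theorem IsForkFull.signFlip_mul (hn : 2 ≤ n) (h : IsForkFull n g) :
    IsForkFull n (signFlip * g) where
  mem := mul_mem (signFlip_mem (by omega)) h.mem
  left := by
    rw [mul_inv_rev, signFlip_inv]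
    exact h.left.mul_signFlip hn (inv_mem h.mem)
  right := h.right.signFlip_mul h.mem
  mixing := h.mixing.signFlip_mul
  above := fun c h2 hc hp => h.above c h2 hc <| by
    have := (preservesAbove_signFlip (by omega)).mul hp
    rwa [signFlip_mul_signFlip_mul] at this

theorem IsForkFull.mul_signFlip (hn : 2 ≤ n) (h : IsForkFull n g) :
    IsForkFull n (g * signFlip) where
  mem := mul_mem h.mem (signFlip_mem (by omega))
  left := by
    rw [mul_inv_rev, signFlip_inv]
    exact h.left.signFlip_mul (inv_mem h.mem)
  right := h.right.mul_signFlip hn h.mem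
  mixing := h.mixing.mul_signFlip
  above := fun c h2 hc hp => h.above c h2 hc <| by
    have := hp.mul (preservesAbove_signFlip (by omega))
    rwa [mul_signFlip_mul_signFlip] at this

/-- The representative of the coset `{g, g * signFlip}` whose first entry is positive. -/
noncomputable def posFirst (g : Perm ℤ) : Perm ℤ := if 0 < g 1 then g else g * signFlip

theorem posFirst_eq (g : Perm ℤ) : posFirst g = g ∨ posFirst g = g * signFlip := by
  unfold posFirst
  split_ifs
  · exact Or.inl rfl
  · exact Or.inr rfl

theorem posFirst_mul_signFlip (hg : g ∈ signedPerm n) : posFirst (g * signFlip) = posFirst g := by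
  have h1 := map_neg_of_mem hg 1
  have h2 := map_pos_ne_zero hg (k := 1) one_ne_zero
  unfold posFirst
  rw [Perm.mul_apply, signFlip_one, h1, mul_signFlip_mul_signFlip]
  split_ifs <;> first | rfl | omega

theorem uniqueForkDescent_iff_blockPerm {x y z b c : ℕ} (hn : 2 ≤ x + y + z + b)
    (hc : c < x + y + z + b) (hb : 1 ≤ b) (hxz : x + z ≠ 1) :
    forkValue (blockPerm x y z b) c < 0 ↔ c = x + z := by
  rcases Nat.eq_zero_or_pos c with rfl | hc0
  · rw [forkValue_zero, blockPerm_apply (by omega), blockPerm_apply (by omega)]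
    split_ifs <;> omega
  · rw [forkValue_of_ne _ hc0, sub_neg, blockPerm_lt_iff hc (Or.inl hb)]

theorem signMixing_of_le (hg : ∃ k : ℤ, 2 ≤ k ∧ g k ≤ -2) : SignMixing g := by
  obtain ⟨k, hk, hgk⟩ := hg
  have h1 := signFlip_of_ne (k := k) (by omega) (by omega)
  have h2 := signFlip_of_ne (k := g k) (by omega) (by omega)
  refine ⟨fun h => ?_, fun h => ?_, fun h => ?_, fun h => ?_⟩ <;> have := h k <;>
    simp only [Perm.mul_apply, h1, h2, Nat.cast_zero] at this <;> omega

theorem isForkFull_blockPerm {x y z b : ℕ} (hn : 4 ≤ x + y + z + b) (hb : 1 ≤ b)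
    (hxz : x + z ≠ 1) (hyz : y + z ≠ 1) (hz : z = 0 → 2 ≤ b ∨ x ≠ 0 ∧ y ≠ 0) :
    IsForkFull (x + y + z + b) (blockPerm x y z b) where
  mem := blockPerm_mem le_rfl
  left := ⟨y + z, Nat.zero_le _, by omega, fun c _ hc => by
    rw [blockPerm_inv]
    exact uniqueForkDescent_iff_blockPerm (by omega) (by omega) hb hyz⟩
  right := ⟨x + z, Nat.zero_le _, by omega, fun c _ hc =>
    uniqueForkDescent_iff_blockPerm (by omega) hc hb hxz⟩
  mixing := by
    refine signMixing_of_le ?_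
    by_cases h : z + x = 0
    · refine ⟨2, le_rfl, ?_⟩
      rw [blockPerm_apply (by omega)]
      split_ifs <;> omega
    · refine ⟨z + x + 1, by omega, ?_⟩
      rw [blockPerm_apply (by omega)]
      split_ifs <;> omega
  above := fun c _ hc => not_preservesAbove_blockPerm hb hc

theorem UniqueForkDescent.exists_increasing (hn : 2 ≤ n) (hg : g ∈ signedPerm n)
    (h : UniqueForkDescent n g) : ∃ d, (d = 1 ∨ d = signFlip ∧ g 1 ≠ 1) ∧ ∃ j, j < n ∧ j ≠ 1 ∧
      ∀ c : ℕ, c < n → c ≠ j → (g * d) c < (g * d) (c + 1) := by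
  obtain ⟨j, -, hj, H⟩ := h
  have hg0 := map_zero_of_mem hg
  have hneg := map_neg_of_mem hg 1
  have hne := map_pos_ne_zero hg (k := 1) one_ne_zero
  have hge : ∀ c : ℕ, c < n → c ≠ j → 0 < forkValue g c := fun c hc hcj =>
    lt_of_le_of_ne (not_lt.1 fun h => hcj ((H c (Nat.zero_le c) hc).1 h))
      (forkValue_ne_zero hg c).symm
  have hstep : ∀ c : ℕ, 1 ≤ c → c < n → c ≠ j → g c < g (c + 1) := fun c hc1 hc hcj => by
    have := hge c hc hcj
    rw [forkValue_of_ne _ hc1] at this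
    omega
  have hflip0 : (g * signFlip) 0 = 0 := hg0
  have hflip1 : (g * signFlip) 1 = -g 1 := by rw [Perm.mul_apply, signFlip_one, hneg]
  have hflip : ∀ k : ℤ, 2 ≤ k → (g * signFlip) k = g k := fun k hk => by
    rw [Perm.mul_apply, signFlip_of_ne (by omega) (by omega)]
  have hstepflip : ∀ c : ℕ, 2 ≤ c → c < n → c ≠ j →
      (g * signFlip) c < (g * signFlip) (c + 1) := fun c hc2 hc hcj => by
    rw [hflip c (by omega), hflip (c + 1) (by omega)]
    exact hstep c (by omega) hc hcj
  by_cases hj0 : j = 0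
  · refine ⟨1, Or.inl rfl, 0, by omega, by omega, fun c hc hc0 => ?_⟩
    rw [mul_one]
    exact hstep c (by omega) hc (by omega)
  by_cases hj1 : j = 1
  · subst hj1
    have h0 := hge 0 (by omega) (by omega)
    have h1 := (H 1 (by omega) (by omega)).2 rfl
    rw [forkValue_zero] at h0
    rw [forkValue_of_ne _ le_rfl] at h1
    norm_num at h1
    refine ⟨signFlip, Or.inr ⟨rfl, ?_⟩, 0, by omega, by omega, fun c hc hc0 => ?_⟩
    · intro h
      have h2 := map_pos_ne_zero hg (k := 2) two_ne_zero
      omega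
    · by_cases hc1 : c = 1
      · subst hc1
        rw [Nat.cast_one, hflip1, hflip (1 + 1) (by omega)]
        norm_num
        omega
      · exact hstepflip c (by omega) hc hc1
  have h0 := hge 0 (by omega) (by omega)
  have h1 := hge 1 (by omega) (by omega)
  rw [forkValue_zero] at h0
  rw [forkValue_of_ne _ le_rfl] at h1
  norm_num at h1
  rcases lt_or_gt_of_ne hne with h | h
  · refine ⟨signFlip, Or.inr ⟨rfl, by omega⟩, j, hj, hj1, fun c hc hcj => ?_⟩
    by_cases hc0 : c = 0
    · subst hc0
      simp only [Nat.cast_zero, zero_add, hflip0, hflip1]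
      omega
    by_cases hc1 : c = 1
    · subst hc1
      rw [Nat.cast_one, hflip1, hflip (1 + 1) (by omega)]
      norm_num
      omega
    · exact hstepflip c (by omega) hc hcj
  · refine ⟨1, Or.inl rfl, j, hj, hj1, fun c hc hcj => ?_⟩
    rw [mul_one]
    by_cases hc0 : c = 0
    · subst hc0
      simpa only [Nat.cast_zero, zero_add, hg0] using h
    · exact hstep c (by omega) hc hcj

theorem IsForkFull.exists_eq_blockPerm (hn : 4 ≤ n) (h : IsForkFull n g) :
    ∃ a d : Perm ℤ, (a = 1 ∨ a = signFlip) ∧ (d = 1 ∨ d = signFlip) ∧ ∃ x y z b : ℕ,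
      x + y + z + b = n ∧ 1 ≤ b ∧ x + z ≠ 1 ∧ y + z ≠ 1 ∧ (z = 0 → 2 ≤ b ∨ x ≠ 0 ∧ y ≠ 0) ∧
      g = a * blockPerm x y z b * d := by
  obtain ⟨d, hd, j, hj, hj1, hR⟩ := h.right.exists_increasing (by omega) h.mem
  have hd' : d = 1 ∨ d = signFlip := hd.imp_right And.left
  have hdd : d * d = 1 := by
    rcases hd' with rfl | rfl
    · exact one_mul 1
    · exact signFlip_mul_self
  have hu : IsForkFull n (g * d) := by
    rcases hd' with rfl | rfl
    · rwa [mul_one]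
    · exact h.mul_signFlip (by omega)
  obtain ⟨a, ha, i, hi, hi1, hL⟩ := hu.left.exists_increasing (by omega) (inv_mem hu.mem)
  have ha' : a = 1 ∨ a = signFlip := ha.imp_right And.left
  have haa : a * a = 1 := by
    rcases ha' with rfl | rfl
    · exact one_mul 1
    · exact signFlip_mul_self
  have hv : IsForkFull n (a * (g * d)) := by
    rcases ha' with rfl | rfl
    · rwa [one_mul]
    · exact hu.signFlip_mul (by omega)
  have hvinv : (a * (g * d))⁻¹ = (g * d)⁻¹ * a := by
    rw [mul_inv_rev, inv_eq_of_mul_eq_one_left haa]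
  have hR' : ∀ c : ℕ, c < n → c ≠ j → (a * (g * d)) c < (a * (g * d)) (c + 1) := by
    intro c hc hcj
    have hlt := hR c hc hcj
    rcases ha with rfl | ⟨rfl, h1⟩
    · simpa only [one_mul] using hlt
    · rw [Perm.mul_apply, Perm.mul_apply signFlip]
      by_cases hc0 : c = 0
      · subst hc0
        have h0 := map_zero_of_mem hu.mem
        simp only [Nat.cast_zero, zero_add, h0] at hlt ⊢
        have hne : (g * d) 1 ≠ 1 := fun h => h1 (by rw [Perm.inv_eq_iff_eq, h])
        rw [signFlip_of_ne hne (by omega)]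
        simpa [signFlip_apply] using hlt
      · refine (signFlip_lt_iff (fun h => ?_) (map_pos_ne_zero hu.mem (by omega))
          (map_pos_ne_zero hu.mem (by omega))).2 hlt
        rw [← map_neg_of_mem hu.mem] at h
        have := (g * d).injective h
        omega
  obtain ⟨x, y, z, b, hsum, hxz, hyz, hE⟩ := NilpotencyIndices.exists_eq_blockPerm hv.mem hi hj hR'
    (by rwa [hvinv]) (fun h => hv.above (n - 1) (by omega) (by omega)
      (preservesAbove_of_map_eq hv.mem (by omega) h))
  obtain ⟨hm1, hm2, hm3, -⟩ := hv.mixing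
  have hEmem := hv.mem
  have hTmem := signFlip_mem (N := n) (by omega)
  rw [hE] at hm1 hm2 hm3 hEmem
  have hb : 1 ≤ b := by
    by_contra hb
    refine hm1 (preservesAbove_zero hEmem fun k hk hkn => ?_)
    rw [blockPerm_apply hk.le]
    split_ifs <;> omega
  refine ⟨a, d, ha', hd', x, y, z, b, hsum, hb, by omega, by omega, fun hz => ?_, ?_⟩
  · subst hz
    by_contra hcon
    rcases Nat.eq_zero_or_pos x with rfl | hx
    · refine hm2 (preservesAbove_zero (mul_mem hEmem hTmem) fun k hk hkn => ?_)
      rw [Perm.mul_apply]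
      by_cases hk1 : k = 1
      · rw [hk1, signFlip_one, map_neg_of_mem hEmem, blockPerm_apply (by omega)]
        split_ifs <;> omega
      · rw [signFlip_of_ne hk1 (by omega), blockPerm_apply (by omega)]
        split_ifs <;> omega
    · refine hm3 (preservesAbove_zero (mul_mem hTmem hEmem) fun k hk hkn => ?_)
      rw [Perm.mul_apply, blockPerm_apply (by omega), signFlip_apply]
      split_ifs <;> omega
  · rw [← hE, ← mul_assoc, ← mul_assoc, haa, one_mul, mul_assoc, hdd, mul_one]

end Fork

/-- The condition on a signed permutation saying that the node `c` of the diagram of type `D` does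
not belong to its support. -/
def ForkAvoids (c : ℕ) (g : Perm ℤ) : Prop :=
  if c = 1 then PreservesAbove 0 (signFlip * g * signFlip) else PreservesAbove c g

section ForkAvoids
variable {c d : ℕ} {g h : Perm ℤ}

theorem forkAvoids_one (c : ℕ) : ForkAvoids c 1 := by
  unfold ForkAvoids
  split_ifs
  · rw [mul_one, signFlip_mul_self]
    exact preservesAbove_one 0
  · exact preservesAbove_one c

theorem ForkAvoids.mul (hg : ForkAvoids c g) (hh : ForkAvoids c h) : ForkAvoids c (g * h) := by
  unfold ForkAvoids at *
  split_ifs at *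
  · have := hg.mul hh
    simpa only [mul_assoc, signFlip_mul_signFlip_mul] using this
  · exact hg.mul hh

theorem forkAvoids_forkGen (hcd : c ≠ d) : ForkAvoids c (forkGen d) := by
  unfold ForkAvoids
  split_ifs with hc
  · intro k
    simp only [Perm.mul_apply, Nat.cast_zero]
    rcases Nat.eq_zero_or_pos d with rfl | hd
    · rw [forkGen_zero, signFlip_apply k]
      split_ifs <;> rw [forkSwap_apply] <;> split_ifs <;> rw [signFlip_apply] <;> split_ifs <;>
        first | omega | contradiction
    · simp only [forkGen_of_ne hd, adjSwap_apply hd, signFlip_apply]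
      split_ifs <;> omega
  · rcases Nat.eq_zero_or_pos d with rfl | hd
    · exact preservesAbove_forkSwap (by omega)
    · rw [forkGen_of_ne hd]
      exact preservesAbove_adjSwap hcd

theorem ForkAvoids.forkValue_nonneg {n : ℕ} (hg : g ∈ signedPerm n) (h : ForkAvoids c g) :
    0 ≤ forkValue g c := by
  unfold ForkAvoids at h
  split_ifs at h with hc
  · subst hc
    have h1 := (h 1).1 (by norm_num)
    have h2 := (h 2).1 (by norm_num)
    have hne : g 1 ≠ -g 2 := fun h => by
      rw [← map_neg_of_mem hg] at h
      have := g.injective h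
      omega
    simp only [Perm.mul_apply, signFlip_one, map_neg_of_mem hg, signFlip_neg, Nat.cast_zero] at h1
    rw [Perm.mul_apply, Perm.mul_apply, signFlip_of_ne (k := 2) (by omega) (by omega),
      Nat.cast_zero] at h2
    rw [forkValue_of_ne _ le_rfl, Nat.cast_one, one_add_one_eq_two]
    rw [signFlip_apply] at h1 h2
    split_ifs at h1 h2 <;> omega
  · rcases Nat.eq_zero_or_pos c with rfl | hc0
    · have h1 := (h 1).1 (by norm_num)
      have h2 := (h 2).1 (by norm_num)
      rw [Nat.cast_zero] at h1 h2
      rw [forkValue_zero]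
      omega
    · rw [forkValue_of_ne _ hc0]
      exact sub_nonneg.2 h.le

end ForkAvoids

theorem eq_one_or_eq_signFlip_of_forkValue_pos {n : ℕ} {g : Perm ℤ} (hn : 2 ≤ n)
    (hg : g ∈ signedPerm n) (h : ∀ c, c < n → 0 < forkValue g c) : g = 1 ∨ g = signFlip := by
  have key : ∀ f : Perm ℤ, f ∈ signedPerm n → (∀ c, c < n → 0 < forkValue f c) → 0 < f 1 →
      f = 1 := by
    intro f hf hpos h1
    refine eq_one_of_strictMono hf fun c hc => ?_
    rcases Nat.eq_zero_or_pos c with rfl | hc0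
    · have h0 := map_zero_of_mem hf
      simpa only [Nat.cast_zero, zero_add, h0] using h1
    · have := hpos c hc
      rw [forkValue_of_ne _ hc0] at this
      omega
  rcases lt_or_gt_of_ne (map_pos_ne_zero hg (k := 1) one_ne_zero) with h1 | h1
  · refine Or.inr ?_
    have := key (g * signFlip) (mul_mem hg (signFlip_mem (by omega))) (fun c hc => by
      rw [forkValue_mul_signFlip hg]
      refine h _ ?_
      rw [swap_apply_def]
      split_ifs <;> omega) (by
      rw [Perm.mul_apply, signFlip_one, map_neg_of_mem hg]
      omega)
    rw [← mul_signFlip_mul_signFlip g, this, one_mul]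
  · exact Or.inl (key g hg h h1)

theorem weight_lt_mul_forkGen {n c : ℕ} {g : Perm ℤ} (hn : 2 ≤ n) (hg : g ∈ signedPerm n)
    (hc : c + 1 ≤ n) (h : forkValue g c < 0) : weight n g < weight n (g * forkGen c) := by
  rcases Nat.eq_zero_or_pos c with rfl | hc0
  · exact weight_lt_mul_forkSwap hn hg h
  · rw [forkValue_of_ne _ hc0, sub_neg] at h
    rw [forkGen_of_ne hc0]
    exact weight_lt_mul_adjSwap hc0 hc h

theorem exists_map_eq_or_eq_mul_signFlip {G : Type*} [Group G] {φ : G →* Perm ℤ} {n : ℕ}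
    {g : Perm ℤ} (hn : 2 ≤ n) (hφ : ∀ c : ℕ, c + 1 ≤ n → ∃ w, φ w = forkGen c)
    (hg : g ∈ signedPerm n) : ∃ w, φ w = g ∨ φ w = g * signFlip := by
  obtain ⟨w, hw⟩ := exists_mul_of_weight_lt (N := n) φ
    (C := fun g => g ∈ signedPerm n) (Z := fun g => g = 1 ∨ g = signFlip) (fun g hg => hg)
    (fun g hg => by
      by_cases H : ∀ c, c < n → 0 < forkValue g c
      · exact Or.inl (eq_one_or_eq_signFlip_of_forkValue_pos hn hg H)
      · push Not at H
        obtain ⟨c, hc, hgc⟩ := H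
        obtain ⟨w, hw⟩ := hφ c hc
        refine Or.inr ⟨w, ?_⟩
        rw [hw]
        exact ⟨mul_mem hg (forkGen_mem hn hc),
          weight_lt_mul_forkGen hn hg hc (lt_of_le_of_ne hgc (forkValue_ne_zero hg c))⟩)
    (inv_mem hg)
  refine ⟨w, hw.imp (fun h => ?_) fun h => ?_⟩
  · rwa [inv_mul_eq_one, eq_comm] at h
  · rwa [inv_mul_eq_iff_eq_mul] at h

theorem IsForkNode.injective {node : B → ℕ} (hM : IsForkNode M node) :
    Function.Injective node := by
  intro s t h
  by_contra hst
  have := hM s t hst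
  omega

section Fork
variable (cs : CoxeterSystem M W) {node : B → ℕ} {n : ℕ} {φ : W →* Perm ℤ}

theorem mem_supp_iff_of_isForkNode (hM : IsForkNode M node)
    (hs : ∀ s, φ (cs.simple s) = forkGen (node s)) (hmem : ∀ w, φ w ∈ signedPerm n)
    (hdesc : ∀ w s, cs.IsRightDescent w s ↔ forkValue (φ w) (node s) < 0) (w : W) (s : B) :
    s ∈ Supp cs w ↔ ¬ ForkAvoids (node s) (φ w) := by
  refine mem_supp_iff_of_invariant cs s (fun w => ForkAvoids (node s) (φ w)) ?_ ?_ ?_ w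
  · rw [map_one]; exact forkAvoids_one _
  · intro w t hts h
    rw [map_mul, hs]
    exact h.mul (forkAvoids_forkGen fun h => hts (hM.injective h.symm))
  · intro w h
    rw [hdesc]
    exact not_lt.2 (h.forkValue_nonneg (hmem w))

theorem injective_of_forkValue
    (hdesc : ∀ w s, cs.IsRightDescent w s ↔ forkValue (φ w) (node s) < 0) :
    Function.Injective φ :=
  hom_injective cs fun w hw s => by
    rw [hdesc, hw, forkValue]
    split_ifs <;> simp

theorem map_ne_signFlip (hdesc : ∀ w s, cs.IsRightDescent w s ↔ forkValue (φ w) (node s) < 0)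
    (w : W) : φ w ≠ signFlip := by
  intro h
  have hw : w ≠ 1 := by
    rintro rfl
    have := DFunLike.congr_fun h 1
    rw [map_one φ, Perm.one_apply, signFlip_one] at this
    omega
  obtain ⟨s, hs⟩ := cs.exists_rightDescent_of_ne_one hw
  rw [hdesc, h, forkValue] at hs
  simp only [signFlip_apply] at hs
  split_ifs at hs <;> omega

theorem bigrassmannian_and_supp_iff (hn : 2 ≤ n) (hM : IsForkNode M node)
    (hnode : ∀ c, (∃ s, node s = c) ↔ 0 ≤ c ∧ c < n)
    (hs : ∀ s, φ (cs.simple s) = forkGen (node s)) (hmem : ∀ w, φ w ∈ signedPerm n)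
    (hdesc : ∀ w s, cs.IsRightDescent w s ↔ forkValue (φ w) (node s) < 0) (w : W) :
    Bigrassmannian cs w ∧ Supp cs w = Set.univ ↔ IsForkFull n (φ w) := by
  rw [bigrassmannian_iff cs (P := fun g c => forkValue g c < 0) hdesc hM.injective hnode,
    supp_eq_univ_iff cs (Q := fun c => ¬ ForkAvoids c (φ w))
      (mem_supp_iff_of_isForkNode cs hM hs hmem hdesc w) hnode]
  constructor
  · rintro ⟨⟨hL, hR⟩, hfull⟩
    have hT := signFlip_mem (N := n) (by omega)
    have hrange : ∀ g ∈ signedPerm n, PreservesAbove 0 g → ∃ v, φ v = g := fun g hg hpos =>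
      exists_map_eq_of_preservesAbove (fun c hc1 hc => by
        obtain ⟨s, rfl⟩ := (hnode c).2 ⟨Nat.zero_le _, hc⟩
        exact ⟨_, (hs s).trans (forkGen_of_ne hc1)⟩) hg hpos
    refine ⟨hmem w, hL, hR, ⟨?_, fun h => ?_, fun h => ?_, ?_⟩, fun c h2 hc => ?_⟩
    · exact hfull 0 le_rfl (by omega)
    · obtain ⟨v, hv⟩ := hrange _ (mul_mem (hmem w) hT) h
      refine map_ne_signFlip cs hdesc (w⁻¹ * v) ?_
      rw [map_mul, hv, map_inv, inv_mul_cancel_left]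
    · obtain ⟨v, hv⟩ := hrange _ (mul_mem hT (hmem w)) h
      refine map_ne_signFlip cs hdesc (v * w⁻¹) ?_
      rw [map_mul, hv, map_inv, mul_inv_cancel_right]
    · exact hfull 1 (by omega) (by omega)
    · have := hfull c (by omega) hc
      rwa [ForkAvoids, if_neg (by omega)] at this
  · intro h
    refine ⟨⟨h.left, h.right⟩, fun c _ hc => ?_⟩
    obtain ⟨h1, -, -, h2⟩ := h.mixing
    unfold ForkAvoids
    split_ifs with hc1
    · exact h2
    · rcases Nat.eq_zero_or_pos c with rfl | hc0
      · exact h1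
      · exact h.above c (by omega) hc

theorem posFirst_injective
    (hdesc : ∀ w s, cs.IsRightDescent w s ↔ forkValue (φ w) (node s) < 0) :
    Function.Injective fun w => posFirst (φ w) := by
  intro v w h
  have hv := map_ne_signFlip cs hdesc (v⁻¹ * w)
  have hw := map_ne_signFlip cs hdesc (w⁻¹ * v)
  rw [map_mul, map_inv, ne_eq, inv_mul_eq_iff_eq_mul] at hv hw
  refine injective_of_forkValue cs hdesc ?_
  dsimp only at h
  rcases posFirst_eq (φ v) with h1 | h1 <;> rcases posFirst_eq (φ w) with h2 | h2 <;>
    rw [h1, h2] at h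
  · exact h
  · exact absurd h hw
  · exact absurd h.symm hv
  · exact mul_right_cancel h

/-- The bigrassmannian elements of full support in type `D` correspond to the cosets of the
subgroup generated by `signFlip` consisting of elements satisfying `IsForkFull`. -/
theorem image_posFirst (hn : 2 ≤ n) (hM : IsForkNode M node)
    (hnode : ∀ c, (∃ s, node s = c) ↔ 0 ≤ c ∧ c < n)
    (hs : ∀ s, φ (cs.simple s) = forkGen (node s)) (hmem : ∀ w, φ w ∈ signedPerm n)
    (hdesc : ∀ w s, cs.IsRightDescent w s ↔ forkValue (φ w) (node s) < 0) :
    (fun w => posFirst (φ w)) '' {w | Bigrassmannian cs w ∧ Supp cs w = Set.univ} =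
      posFirst '' {g | IsForkFull n g} := by
  simp only [bigrassmannian_and_supp_iff cs hn hM hnode hs hmem hdesc]
  ext f
  constructor
  · rintro ⟨w, hw, rfl⟩
    exact ⟨φ w, hw, rfl⟩
  · rintro ⟨g, hg, rfl⟩
    obtain ⟨w, hw⟩ := exists_map_eq_or_eq_mul_signFlip hn (φ := φ) (fun c hc => by
      obtain ⟨s, rfl⟩ := (hnode c).2 ⟨Nat.zero_le _, hc⟩
      exact ⟨_, hs s⟩) hg.mem
    refine ⟨w, ?_, ?_⟩
    · rw [Set.mem_ofPred_eq]
      rcases hw with hw | hw <;> rw [hw]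
      · exact hg
      · exact hg.mul_signFlip hn
    · dsimp only
      rcases hw with hw | hw <;> rw [hw]
      exact posFirst_mul_signFlip hg.mem

end Fork

theorem signFlip_mul_comm {n : ℕ} {g : Perm ℤ} (hg : g ∈ signedPerm n) (h : g 1 = 1) :
    signFlip * g = g * signFlip := by
  have h' : g (-1) = -1 := by rw [map_neg_of_mem hg, h]
  ext k
  rw [Perm.mul_apply, Perm.mul_apply]
  by_cases h1 : k = 1
  · rw [h1, h, signFlip_one, h']
  by_cases h2 : k = -1
  · rw [h2, h', signFlip_neg, signFlip_one, neg_neg, h]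
  rw [signFlip_of_ne h1 h2, signFlip_of_ne]
  · rwa [← h, ne_eq, g.injective.eq_iff]
  · rwa [← h', ne_eq, g.injective.eq_iff]

section BlockPerm
variable {x y z b x' y' z' b' : ℕ} {a d : Perm ℤ}

theorem add_eq_add_of_blockPerm_eq (hn : 2 ≤ x + y + z + b) (hb : 1 ≤ b) (hb' : 1 ≤ b')
    (hsum : x + y + z + b = x' + y' + z' + b') (hxz : x + z ≠ 1) (hxz' : x' + z' ≠ 1)
    (ha : a = 1 ∨ a = signFlip) (hd : d = 1 ∨ d = signFlip)
    (h : blockPerm x y z b = a * blockPerm x' y' z' b' * d) : x + z = x' + z' := by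
  have hE : blockPerm x' y' z' b' ∈ signedPerm (x + y + z + b) := blockPerm_mem hsum.ge
  have hneg := (uniqueForkDescent_iff_blockPerm (x := x) (y := y) (z := z) (b := b)
    (c := x + z) hn (by omega) hb hxz).2 rfl
  rw [h, mul_assoc] at hneg
  have hneg' : forkValue (blockPerm x' y' z' b' * d) (x + z) < 0 := by
    rcases ha with rfl | rfl
    · rwa [one_mul] at hneg
    · rwa [forkValue_signFlip_mul] at hneg
      refine mul_mem hE ?_
      rcases hd with rfl | rfl
      · exact one_mem _
      · exact signFlip_mem (by omega)
  rcases hd with rfl | rfl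
  · rwa [mul_one, uniqueForkDescent_iff_blockPerm (by omega) (by omega) hb' hxz'] at hneg'
  · rw [forkValue_mul_signFlip hE, uniqueForkDescent_iff_blockPerm (by omega) (by
      rw [swap_apply_def]; split_ifs <;> omega) hb' hxz', swap_apply_def] at hneg'
    split_ifs at hneg' <;> omega

theorem blockPerm_eq_of_eq_mul (hn : 2 ≤ x + y + z + b) (hb : 1 ≤ b) (hb' : 1 ≤ b')
    (hsum : x + y + z + b = x' + y' + z' + b') (hxz : x + z ≠ 1) (hxz' : x' + z' ≠ 1)
    (hyz : y + z ≠ 1) (hyz' : y' + z' ≠ 1)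
    (ha : a = 1 ∨ a = signFlip) (hd : d = 1 ∨ d = signFlip)
    (h : blockPerm x y z b = a * blockPerm x' y' z' b' * d) :
    x = x' ∧ y = y' ∧ z = z' ∧ (z = 0 → a = 1) := by
  have hE : blockPerm x' y' z' b' ∈ signedPerm (x + y + z + b) := blockPerm_mem hsum.ge
  have h1 := add_eq_add_of_blockPerm_eq hn hb hb' hsum hxz hxz' ha hd h
  have h2 : y + z = y' + z' := by
    refine add_eq_add_of_blockPerm_eq (x := y) (y := x) (z := z) (b := b) (x' := y') (y' := x')
      (a := d) (d := a) (by omega) hb hb' (by omega) hyz hyz' hd ha ?_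
    have hinv : ∀ e : Perm ℤ, e = 1 ∨ e = signFlip → e⁻¹ = e := by
      rintro e (rfl | rfl)
      · exact inv_one
      · exact signFlip_inv
    rw [← blockPerm_inv, h, mul_inv_rev, mul_inv_rev, hinv a ha, hinv d hd, blockPerm_inv,
      mul_assoc]
  have happ : ∀ k : ℤ, 2 ≤ k → blockPerm x y z b k = a (blockPerm x' y' z' b' k) := by
    intro k hk
    rw [h, Perm.mul_apply, Perm.mul_apply]
    rcases hd with rfl | rfl
    · rfl
    · rw [signFlip_of_ne (by omega) (by omega)]
  have habs : |blockPerm x y z b (x + z + 1)| = |blockPerm x' y' z' b' (x + z + 1)| := by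
    have hleft : ∀ k, |a k| = |k| := by
      intro k
      rcases ha with rfl | rfl
      · rfl
      · exact signFlip_abs k
    rw [h, Perm.mul_apply, Perm.mul_apply, hleft]
    rcases hd with rfl | rfl
    · rfl
    · rw [signFlip_apply]
      split_ifs with h3 h4
      · rw [map_neg_of_mem hE, abs_neg, h3]
      · omega
      · rfl
  rw [blockPerm_apply (by omega), blockPerm_apply (by omega), abs_eq_abs] at habs
  obtain rfl : x = x' := by
    rcases habs with h3 | h3 <;> split_ifs at h3 <;> omega
  refine ⟨rfl, by omega, by omega, fun hz => ?_⟩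
  rcases ha with rfl | rfl
  · rfl
  exfalso
  obtain rfl : z = z' := by omega
  obtain rfl : y = y' := by omega
  obtain rfl : b = b' := by omega
  subst hz
  by_cases hy : y = 0
  · have h3 : blockPerm x y 0 b (x + b) = -1 := by
      rw [blockPerm_apply (by omega)]
      split_ifs <;> omega
    have := happ (x + b) (by omega)
    rw [h3, signFlip_neg, signFlip_one] at this
    omega
  · have h3 : blockPerm x y 0 b (x + b + 1) = 1 := by
      rw [blockPerm_apply (by omega)]
      split_ifs <;> omega
    have := happ (x + b + 1) (by omega)
    rw [h3, signFlip_one] at this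
    omega

end BlockPerm

/-- The parameters of the bigrassmannian elements of full support in type `D`. -/
def forkIndex (n : ℕ) : Set (ℕ × ℕ × ℕ × Bool) :=
  {p | p.1 + p.2.1 + p.2.2.1 < n ∧ p.1 + p.2.2.1 ≠ 1 ∧ p.2.1 + p.2.2.1 ≠ 1 ∧
    (p.2.2.1 = 0 → p.1 + p.2.1 + 2 ≤ n ∨ p.1 ≠ 0 ∧ p.2.1 ≠ 0) ∧
    (p.2.2.1 ≠ 0 → p.2.2.2 = false)}

/-- The signed permutation with the given parameters. -/
noncomputable def forkElement (n : ℕ) (p : ℕ × ℕ × ℕ × Bool) : Perm ℤ :=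
  (if p.2.2.2 then signFlip else 1) *
    blockPerm p.1 p.2.1 p.2.2.1 (n - (p.1 + p.2.1 + p.2.2.1))

theorem image_posFirst_isForkFull {n : ℕ} (hn : 4 ≤ n) :
    posFirst '' {g | IsForkFull n g} = (fun p => posFirst (forkElement n p)) '' forkIndex n := by
  ext f
  constructor
  · rintro ⟨g, hg, rfl⟩
    obtain ⟨a, d, ha, hd, x, y, z, b, hsum, hb, hxz, hyz, hz, rfl⟩ := hg.exists_eq_blockPerm hn
    have hE : blockPerm x y z b ∈ signedPerm n := blockPerm_mem hsum.le
    have hT := signFlip_mem (N := n) (by omega)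
    have haE : a * blockPerm x y z b ∈ signedPerm n := by
      rcases ha with rfl | rfl
      · rwa [one_mul]
      · exact mul_mem hT hE
    have hd' : posFirst (a * blockPerm x y z b * d) = posFirst (a * blockPerm x y z b) := by
      rcases hd with rfl | rfl
      · rw [mul_one]
      · exact posFirst_mul_signFlip haE
    rw [hd']
    have hbn : n - (x + y + z) = b := by omega
    by_cases hza : z = 0 ∧ a = signFlip
    · obtain ⟨rfl, rfl⟩ := hza
      refine ⟨⟨x, y, 0, true⟩, ⟨?_, hxz, hyz, fun _ => ?_, fun h => absurd rfl h⟩, ?_⟩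
      · dsimp only; omega
      · have := hz rfl
        dsimp only; omega
      · simp only [forkElement, if_true, hbn]
    · refine ⟨⟨x, y, z, false⟩, ⟨?_, hxz, hyz, fun h => ?_, fun _ => rfl⟩, ?_⟩
      · dsimp only; omega
      · have := hz h
        dsimp only at h ⊢; omega
      · simp only [forkElement, Bool.false_eq_true, if_false, one_mul, hbn]
        rcases ha with rfl | rfl
        · rw [one_mul]
        · have hz0 : z ≠ 0 := fun h => hza ⟨h, rfl⟩
          rw [signFlip_mul_comm hE, posFirst_mul_signFlip hE]
          rw [blockPerm_apply (by omega), if_pos (by omega)]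
  · rintro ⟨⟨x, y, z, e⟩, ⟨h1, h2, h3, h4, -⟩, rfl⟩
    dsimp only at h1 h2 h3 h4
    have hfull := isForkFull_blockPerm (x := x) (y := y) (z := z) (b := n - (x + y + z))
      (by omega) (by omega) h2 h3 fun hz => by have := h4 hz; omega
    rw [Nat.add_sub_cancel' h1.le] at hfull
    refine ⟨forkElement n (x, y, z, e), ?_, rfl⟩
    simp only [forkElement, Set.mem_ofPred_eq]
    split_ifs
    · exact hfull.signFlip_mul (by omega)
    · rwa [one_mul]

theorem injOn_posFirst_forkElement {n : ℕ} (hn : 2 ≤ n) :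
    Set.InjOn (fun p => posFirst (forkElement n p)) (forkIndex n) := by
  rintro ⟨x, y, z, e⟩ ⟨h1, h2, h3, -, h5⟩ ⟨x', y', z', e'⟩ ⟨h1', h2', h3', -, h5'⟩ h
  dsimp only at h1 h2 h3 h5 h1' h2' h3' h5' h
  obtain ⟨d, hd, hgd⟩ : ∃ d, (d = 1 ∨ d = signFlip) ∧
      forkElement n (x, y, z, e) = forkElement n (x', y', z', e') * d := by
    rcases posFirst_eq (forkElement n (x, y, z, e)) with hp | hp <;>
      rcases posFirst_eq (forkElement n (x', y', z', e')) with hq | hq <;> rw [hp, hq] at h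
    · exact ⟨1, Or.inl rfl, by rw [h, mul_one]⟩
    · exact ⟨signFlip, Or.inr rfl, h⟩
    · exact ⟨signFlip, Or.inr rfl, by rw [← h, mul_signFlip_mul_signFlip]⟩
    · exact ⟨1, Or.inl rfl, by rw [mul_right_cancel h, mul_one]⟩
  obtain ⟨a, ha, hee, hE⟩ : ∃ a, (a = 1 ∨ a = signFlip) ∧ (a = 1 → e = e') ∧
      blockPerm x y z (n - (x + y + z)) = a * blockPerm x' y' z' (n - (x' + y' + z')) * d := by
    have hne : signFlip ≠ 1 := fun h => by
      have := DFunLike.congr_fun h 1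
      rw [signFlip_one, Perm.one_apply] at this
      omega
    cases e <;> cases e' <;>
      simp only [forkElement, Bool.false_eq_true, if_false, if_true, one_mul] at hgd
    · exact ⟨1, Or.inl rfl, fun _ => rfl, by rwa [one_mul]⟩
    · exact ⟨signFlip, Or.inr rfl, fun h => absurd h hne, hgd⟩
    · exact ⟨signFlip, Or.inr rfl, fun h => absurd h hne, by
        rw [mul_assoc, ← hgd, signFlip_mul_signFlip_mul]⟩
    · refine ⟨1, Or.inl rfl, fun _ => rfl, ?_⟩
      rw [mul_assoc] at hgd
      rw [one_mul, mul_left_cancel hgd]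
  obtain ⟨rfl, rfl, rfl, hz⟩ := blockPerm_eq_of_eq_mul (by omega) (by omega) (by omega) (by omega)
    h2 h2' h3 h3' ha hd hE
  have : e = e' := by
    by_cases h0 : z = 0
    · exact hee (hz h0)
    · rw [h5 h0, h5' h0]
  rw [this]

/-- The increasing enumeration of the natural numbers different from `1`. -/
def skipOne (t : ℕ) : ℕ := if t = 0 then 0 else t + 1

theorem ncard_forkIndex {n : ℕ} (hn : 4 ≤ n) :
    (forkIndex n).ncard = (n - 2) * (n ^ 2 + 8 * n - 15) / 6 := by
  obtain ⟨m, rfl⟩ := Nat.exists_eq_add_of_le' hn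
  let S := (tetrahedron (m + 2)).disjSum ((triangle (m + 1)).disjSum
    ((triangle (m + 2)).disjSum (triangle (m + 2))))
  let f : ((Σ _ : ℕ, Σ _ : ℕ, ℕ) ⊕ (Σ _ : ℕ, ℕ) ⊕ (Σ _ : ℕ, ℕ) ⊕ (Σ _ : ℕ, ℕ)) →
      ℕ × ℕ × ℕ × Bool :=
    Sum.elim (fun p => (p.2.2, p.2.1 - p.2.2, p.1 - p.2.1 + 2, false)) <|
      Sum.elim (fun p => (p.2 + 1, p.1 - p.2 + 1, 1, false)) <|
        Sum.elim (fun p => (skipOne p.2, skipOne (p.1 - p.2), 0, false))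
          (fun p => (skipOne p.2, skipOne (p.1 - p.2), 0, true))
  have hcard : S.card * 6 = (m + 2) * (m ^ 2 + 16 * m + 33) := by
    simp only [S, Finset.card_disjSum]
    linarith [card_tetrahedron (m + 2), card_triangle (m + 1), card_triangle (m + 2)]
  have hf : Set.InjOn f S := by
    intro p hp q hq hpq
    rw [Finset.mem_coe] at hp hq
    rcases p with ⟨s, t, u⟩ | ⟨s, t⟩ | ⟨s, t⟩ | ⟨s, t⟩ <;>
      rcases q with ⟨s', t', u'⟩ | ⟨s', t'⟩ | ⟨s', t'⟩ | ⟨s', t'⟩ <;>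
      simp [S, f, skipOne, mem_triangle, mem_tetrahedron] at hp hq hpq ⊢ <;> grind
  have himage : f '' S = forkIndex (m + 4) := by
    ext ⟨x, y, z, e⟩
    simp only [Set.mem_image, Finset.mem_coe, forkIndex, Set.mem_ofPred_eq]
    constructor
    · rintro ⟨⟨s, t, u⟩ | ⟨s, t⟩ | ⟨s, t⟩ | ⟨s, t⟩, hp, hpq⟩ <;>
      simp [S, f, skipOne, mem_triangle, mem_tetrahedron] at hp hpq ⊢ <;> grind
    · rintro ⟨h1, h2, h3, h4, h5⟩
      by_cases hz : 2 ≤ z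
      · obtain ⟨z, rfl⟩ := Nat.exists_eq_add_of_le' hz
        refine ⟨Sum.inl ⟨x + y + z, x + y, x⟩, ?_, ?_⟩
        · simp [S, mem_tetrahedron]; omega
        · simp [f, h5]
      by_cases hz1 : z = 1
      · subst hz1
        refine ⟨Sum.inr (Sum.inl ⟨x - 1 + (y - 1), x - 1⟩), ?_, ?_⟩
        · simp [S, mem_triangle]; omega
        · simp [f, h5]; omega
      obtain rfl : z = 0 := by omega
      have hx : skipOne (x - 1) = x := by unfold skipOne; split_ifs <;> omega
      have hy : skipOne (y - 1) = y := by unfold skipOne; split_ifs <;> omega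
      cases e
      · refine ⟨Sum.inr (Sum.inr (Sum.inl ⟨x - 1 + (y - 1), x - 1⟩)), ?_, ?_⟩
        · simp [S, mem_triangle]; omega
        · simp [f, hx, hy]
      · refine ⟨Sum.inr (Sum.inr (Sum.inr ⟨x - 1 + (y - 1), x - 1⟩)), ?_, ?_⟩
        · simp [S, mem_triangle]; omega
        · simp [f, hx, hy]
  rw [← himage, hf.ncard_image, Set.ncard_coe_finset]
  refine (Nat.div_eq_of_eq_mul_left (by norm_num) ?_).symm
  rw [hcard]
  congr 1
  have : (m + 4) ^ 2 + 8 * (m + 4) = m ^ 2 + 16 * m + 33 + 15 := by ring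
  rw [this, Nat.add_sub_cancel]

theorem card_typeD {n : ℕ} (hn : 4 ≤ n) (cs : CoxeterSystem M W) {node : B → ℕ}
    (hM : IsForkNode M node) (hnode : ∀ c, (∃ s, node s = c) ↔ 0 ≤ c ∧ c < n) :
    Nat.card {w : W // Bigrassmannian cs w ∧ Supp cs w = Set.univ} =
      (n - 2) * (n ^ 2 + 8 * n - 15) / 6 := by
  obtain ⟨φ, hs, hmem, hdesc⟩ := exists_hom_of_isForkNode cs hM (N := n) (by omega)
    fun s => ((hnode _).1 ⟨s, rfl⟩).2
  change Nat.card ↥{w | Bigrassmannian cs w ∧ Supp cs w = Set.univ} = _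
  rw [Nat.card_coe_set_eq, ← Set.ncard_image_of_injective _ (posFirst_injective cs hdesc),
    image_posFirst cs (by omega) hM hnode hs hmem hdesc, image_posFirst_isForkFull hn,
    (injOn_posFirst_forkElement (by omega)).ncard_image, ncard_forkIndex hn]

theorem isForkNode_ite {n : ℕ} (hn : 4 ≤ n) {M : CoxeterMatrix (Fin n)}
    (hM : ∀ i j : Fin n, M i j =
      if i = j then 1
      else if (((i : ℕ) + 1 = (j : ℕ) ∨ (j : ℕ) + 1 = (i : ℕ)) ∧
            max (i : ℕ) (j : ℕ) ≤ n - 2)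
          ∨ (min (i : ℕ) (j : ℕ) = n - 3 ∧ max (i : ℕ) (j : ℕ) = n - 1) then 3
      else 2) :
    IsForkNode M fun i => if (i : ℕ) = n - 1 then 0 else n - 1 - i := by
  intro s t hst
  have hne := Fin.val_ne_of_ne hst
  have hs := s.isLt
  have ht := t.isLt
  rw [hM, if_neg hst]
  clear hM hst
  dsimp only
  generalize (s : ℕ) = i at *
  generalize (t : ℕ) = j at *
  rcases lt_or_gt_of_ne hne with h | h
  · rw [max_eq_right h.le, min_eq_left h.le, if_neg (by omega : ¬ i = n - 1)]
    by_cases hj : j = n - 1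
    · rw [if_pos hj]
      split_ifs <;> omega
    · rw [if_neg hj]
      split_ifs <;> omega
  · rw [max_eq_left h.le, min_eq_right h.le, if_neg (by omega : ¬ j = n - 1)]
    by_cases hi : i = n - 1
    · rw [if_pos hi]
      split_ifs <;> omega
    · rw [if_neg hi]
      split_ifs <;> omega

/-- Counts of bigrassmannian elements of full support in types `A_n` (`n ≥ 2`),
`B_n` (`n ≥ 2`) and `D_n` (`n ≥ 4`). -/
theorem card_bigrassmannian_full_support_ABD :
    (∀ n : ℕ, 2 ≤ n → ∀ M : CoxeterMatrix (Fin n),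
      (∀ i j : Fin n, M i j =
        if i = j then 1 else if (i : ℕ) + 1 = (j : ℕ) ∨ (j : ℕ) + 1 = (i : ℕ) then 3 else 2) →
      ∀ (V : Type*) [Group V], ∀ cs : CoxeterSystem M V,
        Nat.card {w : V // Bigrassmannian cs w ∧ Supp cs w = Set.univ} = n) ∧
    (∀ n : ℕ, 2 ≤ n → ∀ M : CoxeterMatrix (Fin n),
      (∀ i j : Fin n, M i j =
        if i = j then 1
        else if (i : ℕ) + 1 = (j : ℕ) ∨ (j : ℕ) + 1 = (i : ℕ) then
          (if max (i : ℕ) (j : ℕ) = n - 1 then 4 else 3)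
        else 2) →
      ∀ (V : Type*) [Group V], ∀ cs : CoxeterSystem M V,
        Nat.card {w : V // Bigrassmannian cs w ∧ Supp cs w = Set.univ} =
          n * (n + 1) * (n + 2) / 6) ∧
    (∀ n : ℕ, 4 ≤ n → ∀ M : CoxeterMatrix (Fin n),
      (∀ i j : Fin n, M i j =
        if i = j then 1
        else if (((i : ℕ) + 1 = (j : ℕ) ∨ (j : ℕ) + 1 = (i : ℕ)) ∧
              max (i : ℕ) (j : ℕ) ≤ n - 2)
            ∨ (min (i : ℕ) (j : ℕ) = n - 3 ∧ max (i : ℕ) (j : ℕ) = n - 1) then 3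
        else 2) →
      ∀ (V : Type*) [Group V], ∀ cs : CoxeterSystem M V,
        Nat.card {w : V // Bigrassmannian cs w ∧ Supp cs w = Set.univ} =
          (n - 2) * (n ^ 2 + 8 * n - 15) / 6) := by
  refine ⟨fun n hn M hM V _ cs => ?_, fun n hn M hM V _ cs => ?_, fun n hn M hM V _ cs => ?_⟩
  · refine card_typeA hn cs (node := fun i => i + 1) (fun s t hst => ?_) fun c =>
      ⟨?_, fun h => ⟨⟨c - 1, by omega⟩, ?_⟩⟩
    · rw [hM, if_neg hst]
      have hne := Fin.val_ne_of_ne hst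
      dsimp only
      split_ifs <;> omega
    · rintro ⟨s, rfl⟩
      omega
    · simp only
      omega
  · refine card_typeB hn cs (node := fun i => n - 1 - i) (fun s t hst => ?_) fun c =>
      ⟨?_, fun h => ⟨⟨n - 1 - c, by omega⟩, ?_⟩⟩
    · rw [hM, if_neg hst]
      have hne := Fin.val_ne_of_ne hst
      dsimp only
      split_ifs <;> omega
    · rintro ⟨s, rfl⟩
      omega
    · simp only
      omega
  · refine card_typeD hn cs (isForkNode_ite hn hM) fun c =>
      ⟨?_, fun h => ⟨⟨if c = 0 then n - 1 else n - 1 - c, by split_ifs <;> omega⟩, ?_⟩⟩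
    · rintro ⟨s, rfl⟩
      have hs := s.isLt
      split_ifs <;> omega
    · dsimp only
      by_cases hc : c = 0
      · simp only [if_true, hc]
      · simp only [if_neg hc, if_neg (show ¬ n - 1 - c = n - 1 by omega)]
        omega

end NilpotencyIndices
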